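/- arXiv:2012.14382 — 2 statements merged into one kernel-verified Lean document; each statement's English description precedes it below -/
import Mathlib

section
/- Let V : ℝ³ → ℝ be smooth with V and all its partial derivatives bounded, and let ψ : ℝ × ℝ³ → ℂ be smooth such that for every t ∈ ℝ the function x ↦ ψ(t,x) is a Schwartz function, t ↦ ψ(t,·) is a smooth curve in Schwartz space, and ψ solves the Schrödinger equation i ∂_t ψ(t,x) = −Δψ(t,x) + V(x) ψ(t,x) for all (t,x). Then the function t ↦ ∫_{ℝ³} ‖x‖² |ψ(t,x)|² dx is twice differentiable and its second derivative equals ∫_{ℝ³} ( 8 ‖∇ψ(t,x)‖² − 4 (x · ∇V(x)) |ψ(t,x)|² ) dx for every t, where x · ∇V = Σ_{j=1}^{3} x_j ∂_{x_j} V and ‖∇ψ‖² = Σ_{j=1}^{3} |∂_{x_j} ψ|². -/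
open MeasureTheory
open scoped ContDiff

namespace DilId
open SchwartzMap Complex

abbrev E := EuclideanSpace ℝ (Fin 3)

noncomputable def ee (j : Fin 3) : E := EuclideanSpace.single j 1

noncomputable def dd (j : Fin 3) (f : E → ℂ) : E → ℂ := fun x => fderiv ℝ f x (ee j)

noncomputable def lap (f : E → ℂ) : E → ℂ := fun x => ∑ j : Fin 3, dd j (dd j f) x

noncomputable def dt (u : ℝ → E → ℂ) : ℝ → E → ℂ := fun t x => deriv (fun τ => u τ x) t

def Sm (f : E → ℂ) : Prop := ContDiff ℝ ∞ f

def Sm2 (u : ℝ → E → ℂ) : Prop := ContDiff ℝ ∞ (Function.uncurry u)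

structure Sol (V : E → ℝ) (u : ℝ → E → ℂ) : Prop where
  sm : Sm2 u
  eq : ∀ t x, dt u t x = I * (lap (u t) x - V x * u t x)

lemma Sm.diff {f : E → ℂ} (h : Sm f) : Differentiable ℝ f :=
  ContDiff.differentiable h (by simp)

lemma Sm.cont {f : E → ℂ} (h : Sm f) : Continuous f := ContDiff.continuous h

lemma Sm.dd {f : E → ℂ} (h : Sm f) (j) : Sm (dd j f) := by
  unfold Sm DilId.dd at *
  exact (h.fderiv_right (m := ∞) (by simp)).clm_apply contDiff_const

lemma Sm.lap {f : E → ℂ} (h : Sm f) : Sm (lap f) := by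
  unfold Sm DilId.lap
  exact ContDiff.sum fun j _ => (h.dd j).dd j

lemma Sm.mul {f g : E → ℂ} (h : Sm f) (h' : Sm g) : Sm (fun x => f x * g x) := ContDiff.mul h h'
lemma Sm.add {f g : E → ℂ} (h : Sm f) (h' : Sm g) : Sm (fun x => f x + g x) := ContDiff.add h h'
lemma Sm.sub {f g : E → ℂ} (h : Sm f) (h' : Sm g) : Sm (fun x => f x - g x) := ContDiff.sub h h'
lemma Sm.const (c : ℂ) : Sm (fun _ => c) := contDiff_const
lemma Sm.conj {f : E → ℂ} (h : Sm f) : Sm (fun x => (starRingEnd ℂ) (f x)) :=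
  (conjCLE.contDiff).comp h
lemma Sm.ofReal {f : E → ℝ} (h : ContDiff ℝ ∞ f) : Sm (fun x => (f x : ℂ)) :=
  (ofRealCLM.contDiff).comp h

lemma dd_mul {f g : E → ℂ} (hf : Sm f) (hg : Sm g) (j) (x) :
    dd j (fun x => f x * g x) x = dd j f x * g x + f x * dd j g x := by
  unfold dd
  rw [fderiv_fun_mul (hf.diff x) (hg.diff x)]
  simp; ring

lemma dd_add {f g : E → ℂ} (hf : Sm f) (hg : Sm g) (j) (x) :
    dd j (fun x => f x + g x) x = dd j f x + dd j g x := by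
  unfold dd
  rw [fderiv_fun_add (hf.diff x) (hg.diff x)]
  simp

lemma dd_sub {f g : E → ℂ} (hf : Sm f) (hg : Sm g) (j) (x) :
    dd j (fun x => f x - g x) x = dd j f x - dd j g x := by
  unfold dd
  rw [fderiv_fun_sub (hf.diff x) (hg.diff x)]
  simp

lemma dd_const_mul (c : ℂ) {g : E → ℂ} (hg : Sm g) (j) (x) :
    dd j (fun x => c * g x) x = c * dd j g x := by
  unfold dd
  rw [fderiv_const_mul (hg.diff x)]
  simp

lemma dd_conj (f : E → ℂ) (j) (x) :
    dd j (fun x => (starRingEnd ℂ) (f x)) x = (starRingEnd ℂ) (dd j f x) := by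
  unfold dd
  have := conjCLE.comp_fderiv (f := f) (x := x)
  have h2 : (fun x => (starRingEnd ℂ) (f x)) = conjCLE ∘ f := by ext; simp
  rw [h2, this]; simp

lemma dd_ofReal {f : E → ℝ} (hf : Differentiable ℝ f) (j) (x) :
    dd j (fun x => (f x : ℂ)) x = (fderiv ℝ f x (ee j) : ℝ) := by
  unfold dd
  have h := (ofRealCLM.hasFDerivAt (x := f x)).comp x (hf x).hasFDerivAt
  have h2 : (fun x => (f x : ℂ)) = ofRealCLM ∘ f := by ext; simp
  rw [h2, h.fderiv]; simp

lemma lap_sub {f g : E → ℂ} (hf : Sm f) (hg : Sm g) (x) :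
    lap (fun x => f x - g x) x = lap f x - lap g x := by
  unfold lap
  rw [← Finset.sum_sub_distrib]
  refine Finset.sum_congr rfl fun j _ => ?_
  have : dd j (fun x => f x - g x) = fun x => dd j f x - dd j g x := by
    ext x; exact dd_sub hf hg j x
  rw [this, dd_sub (hf.dd j) (hg.dd j)]

lemma lap_conj (f : E → ℂ) (x) :
    lap (fun x => (starRingEnd ℂ) (f x)) x = (starRingEnd ℂ) (lap f x) := by
  unfold lap
  rw [map_sum]
  refine Finset.sum_congr rfl fun j _ => ?_
  have : dd j (fun x => (starRingEnd ℂ) (f x)) = fun x => (starRingEnd ℂ) (dd j f x) := by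
    ext x; exact dd_conj f j x
  rw [this, dd_conj]

/-! space-time calculus -/

lemma Sm2.slice {u : ℝ → E → ℂ} (h : Sm2 u) (t : ℝ) : Sm (u t) := by
  have : u t = Function.uncurry u ∘ fun x => (t, x) := rfl
  unfold Sm; rw [this]
  exact ContDiff.comp h (contDiff_const.prodMk contDiff_id)

lemma Sm2.tslice {u : ℝ → E → ℂ} (h : Sm2 u) (x : E) : ContDiff ℝ ∞ (fun t => u t x) := by
  have : (fun t => u t x) = Function.uncurry u ∘ fun t => (t, x) := rfl
  rw [this]
  exact ContDiff.comp h (contDiff_id.prodMk contDiff_const)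

lemma Sm2.fd {u : ℝ → E → ℂ} (h : Sm2 u) (p : ℝ × E) :
    HasFDerivAt (Function.uncurry u) (fderiv ℝ (Function.uncurry u) p) p :=
  (ContDiff.differentiable h (by simp) p).hasFDerivAt

lemma dt_eq {u : ℝ → E → ℂ} (h : Sm2 u) (t x) :
    dt u t x = fderiv ℝ (Function.uncurry u) (t, x) (1, 0) := by
  unfold dt
  have h1 := (h.fd (t, x)).comp_hasDerivAt t
    ((hasDerivAt_id t).prodMk (hasDerivAt_const t x))
  exact h1.deriv

lemma dd_eq {u : ℝ → E → ℂ} (h : Sm2 u) (j t x) :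
    dd j (u t) x = fderiv ℝ (Function.uncurry u) (t, x) (0, ee j) := by
  unfold dd
  have h1 := (h.fd (t, x)).comp x
    ((hasFDerivAt_const t x).prodMk (hasFDerivAt_id (𝕜 := ℝ) x))
  have h2 : u t = Function.uncurry u ∘ Prod.mk t := rfl
  rw [h2, h1.fderiv]; simp

lemma Sm2.hasDeriv {u : ℝ → E → ℂ} (h : Sm2 u) (t x) :
    HasDerivAt (fun τ => u τ x) (dt u t x) t :=
  ((h.tslice x).differentiable (by simp) t).hasDerivAt

lemma Sm2.dt {u : ℝ → E → ℂ} (h : Sm2 u) : Sm2 (dt u) := by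
  have : Function.uncurry (DilId.dt u) = fun p => fderiv ℝ (Function.uncurry u) p (1, 0) := by
    ext ⟨t, x⟩; exact dt_eq h t x
  unfold Sm2; rw [this]
  exact (ContDiff.fderiv_right (m := ∞) h (by simp)).clm_apply contDiff_const

lemma Sm2.dd {u : ℝ → E → ℂ} (h : Sm2 u) (j) : Sm2 (fun t => dd j (u t)) := by
  have : Function.uncurry (fun t => DilId.dd j (u t))
      = fun p => fderiv ℝ (Function.uncurry u) p (0, ee j) := by
    ext ⟨t, x⟩; exact dd_eq h j t x
  unfold Sm2; rw [this]
  exact (ContDiff.fderiv_right (m := ∞) h (by simp)).clm_apply contDiff_const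

lemma dt_dd {u : ℝ → E → ℂ} (h : Sm2 u) (j t x) :
    dt (fun t => dd j (u t)) t x = dd j (dt u t) x := by
  rw [dt_eq (h.dd j), dd_eq h.dt]
  have h1 : Function.uncurry (fun t => DilId.dd j (u t))
      = fun p => fderiv ℝ (Function.uncurry u) p (0, ee j) := by
    ext ⟨t, x⟩; exact dd_eq h j t x
  have h2 : Function.uncurry (DilId.dt u) = fun p => fderiv ℝ (Function.uncurry u) p (1, 0) := by
    ext ⟨t, x⟩; exact dt_eq h t x
  have hd : DifferentiableAt ℝ (fderiv ℝ (Function.uncurry u)) (t, x) :=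
    (ContDiff.fderiv_right (m := ∞) h (by simp)).differentiable (by simp) _
  rw [h1, h2, fderiv_clm_apply hd (by fun_prop), fderiv_clm_apply hd (by fun_prop)]
  have hs : IsSymmSndFDerivAt ℝ (Function.uncurry u) (t, x) :=
    (ContDiff.contDiffAt h).isSymmSndFDerivAt (by simp; exact WithTop.coe_le_coe.2 (le_top (a := (2 : ℕ∞))))
  simp
  exact hs.eq _ _

lemma Sm2.lap {u : ℝ → E → ℂ} (h : Sm2 u) : Sm2 (fun t => lap (u t)) := by
  unfold Sm2
  have : Function.uncurry (fun t => DilId.lap (u t)) =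
    fun p => ∑ j : Fin 3, Function.uncurry (fun t => DilId.dd j (DilId.dd j (u t))) p := rfl
  rw [this]
  exact ContDiff.sum fun j _ => (h.dd j).dd j

lemma dt_lap {u : ℝ → E → ℂ} (h : Sm2 u) (t x) :
    dt (fun t => lap (u t)) t x = lap (dt u t) x := by
  have h1 : HasDerivAt (fun τ => ∑ j : Fin 3, dd j (dd j (u τ)) x)
      (∑ j : Fin 3, dt (fun t => dd j (dd j (u t))) t x) t :=
    HasDerivAt.fun_sum fun j _ => ((h.dd j).dd j).hasDeriv t x
  have h2 : dt (fun t => lap (u t)) t x = _ := h1.deriv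
  rw [h2]; unfold lap
  refine Finset.sum_congr rfl fun j _ => ?_
  rw [dt_dd (h.dd j)]
  congr 1; ext y; exact dt_dd h j t y

lemma Sol.hasDeriv {V : E → ℝ} {u : ℝ → E → ℂ} (h : Sol V u) (t x) :
    HasDerivAt (fun τ => u τ x) (I * (lap (u t) x - V x * u t x)) t := by
  rw [← h.eq]; exact h.sm.hasDeriv t x

lemma Sol.dt {V : E → ℝ} {u : ℝ → E → ℂ} (h : Sol V u) : Sol V (dt u) := by
  refine ⟨h.sm.dt, fun t x => ?_⟩
  have h0 : (fun τ => DilId.dt u τ x) = fun τ => I * (DilId.lap (u τ) x - V x * u τ x) := by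
    ext τ; exact h.eq τ x
  have h1 : HasDerivAt (fun τ => I * (DilId.lap (u τ) x - V x * u τ x))
      (I * (DilId.lap (DilId.dt u t) x - V x * DilId.dt u t x)) t := by
    rw [← dt_lap h.sm]
    exact ((h.sm.lap.hasDeriv t x).sub ((h.sm.hasDeriv t x).const_mul _)).const_mul _
  show deriv (fun τ => DilId.dt u τ x) t = _
  rw [h0]; exact h1.deriv

/-- time reversal -/
lemma Sol.rev {V : E → ℝ} {u : ℝ → E → ℂ} (h : Sol V u) :
    Sol V (fun t x => (starRingEnd ℂ) (u (-t) x)) := by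
  refine ⟨?_, fun t x => ?_⟩
  · exact (conjCLE.contDiff).comp
      (ContDiff.comp h.sm (contDiff_fst.neg.prodMk contDiff_snd))
  · have h1 := (h.hasDeriv (-t) x).scomp t (hasDerivAt_neg t)
    have h2 := (conjCLE.hasFDerivAt (x := u (-t) x)).comp_hasDerivAt t h1
    have h3 : DilId.dt (fun t x => (starRingEnd ℂ) (u (-t) x)) t x = _ := h2.deriv
    rw [h3, lap_conj]
    simp

end DilId

namespace DilId
open SchwartzMap Complex
open scoped LineDeriv

def Sch (f : E → ℂ) : Prop := ∃ φ : SchwartzMap E ℂ, ∀ x, f x = φ x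

lemma Sch.eq {f : E → ℂ} (h : Sch f) : ∃ φ : SchwartzMap E ℂ, f = φ := by
  obtain ⟨φ, hφ⟩ := h; exact ⟨φ, funext hφ⟩

lemma Sch.sm {f : E → ℂ} (h : Sch f) : Sm f := by
  obtain ⟨φ, rfl⟩ := h.eq; exact φ.smooth ⊤

lemma Sch.integrable {f : E → ℂ} (h : Sch f) : Integrable f := by
  obtain ⟨φ, rfl⟩ := h.eq; exact φ.integrable

lemma Sch.dd {f : E → ℂ} (h : Sch f) (j) : Sch (dd j f) := by
  obtain ⟨φ, rfl⟩ := h.eq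
  exact ⟨∂_{ee j} φ, fun x => (SchwartzMap.lineDerivOp_apply_eq_fderiv (ee j) φ x).symm⟩

lemma Sch.tmul {f g : E → ℂ} (hg : g.HasTemperateGrowth) (h : Sch f) :
    Sch (fun x => g x * f x) := by
  obtain ⟨φ, rfl⟩ := h.eq
  exact ⟨SchwartzMap.smulLeftCLM ℂ g φ, fun x => by
    rw [SchwartzMap.smulLeftCLM_apply_apply hg]; rfl⟩

lemma Sch.temp {f : E → ℂ} (h : Sch f) : f.HasTemperateGrowth := by
  obtain ⟨φ, rfl⟩ := h.eq; exact φ.hasTemperateGrowth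

lemma Sch.mul {f g : E → ℂ} (h : Sch f) (hg : Sch g) : Sch (fun x => f x * g x) :=
  hg.tmul h.temp

lemma Sch.add {f g : E → ℂ} (h : Sch f) (hg : Sch g) : Sch (fun x => f x + g x) := by
  obtain ⟨φ, rfl⟩ := h.eq
  obtain ⟨φ', rfl⟩ := hg.eq
  exact ⟨φ + φ', fun x => rfl⟩

lemma Sch.sub {f g : E → ℂ} (h : Sch f) (hg : Sch g) : Sch (fun x => f x - g x) := by
  obtain ⟨φ, rfl⟩ := h.eq
  obtain ⟨φ', rfl⟩ := hg.eq
  exact ⟨φ - φ', fun x => rfl⟩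

lemma Sch.cmul {f : E → ℂ} (c : ℂ) (h : Sch f) : Sch (fun x => c * f x) :=
  h.tmul (.const c)

lemma Sch.zero : Sch (fun _ => 0) := ⟨0, fun _ => rfl⟩

lemma Sch.sum {f : Fin 3 → E → ℂ} (h : ∀ j, Sch (f j)) : Sch (fun x => ∑ j, f j x) := by
  simp only [Fin.sum_univ_three]
  exact ((h 0).add (h 1)).add (h 2)

lemma Sch.lap {f : E → ℂ} (h : Sch f) : Sch (lap f) := Sch.sum fun j => (h.dd j).dd j

lemma Sch.conj {f : E → ℂ} (h : Sch f) : Sch (fun x => (starRingEnd ℂ) (f x)) := by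
  obtain ⟨φ, rfl⟩ := h.eq
  exact ⟨SchwartzMap.postcompCLM (conjCLE : ℂ →L[ℝ] ℂ) φ, fun x => by
    rw [SchwartzMap.postcompCLM_apply]; simp⟩

lemma Sch.of_compact {f : E → ℂ} (hf : Sm f) (hc : HasCompactSupport f) : Sch f :=
  ⟨hc.toSchwartzMap hf, fun _ => rfl⟩

lemma Sch.int_dd {f : E → ℂ} (h : Sch f) (j) : ∫ x, DilId.dd j f x = 0 := by
  have h1 : ∫ x, (1 : ℂ) * fderiv ℝ f x (ee j) = - ∫ x, fderiv ℝ (fun _ : E => (1 : ℂ)) x (ee j) * f x := by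
    refine integral_mul_fderiv_eq_neg_fderiv_mul_of_integrable ?_ ?_ ?_ ?_ ?_
    · simp
    · have := (h.dd j).integrable; unfold DilId.dd at this; simpa using this
    · simpa using h.integrable
    · fun_prop
    · exact fun x _ => h.sm.diff x
  simpa [DilId.dd] using h1

/-- three-term divergence -/
lemma Sch.int_div {F : Fin 3 → E → ℂ} (h : ∀ j, Sch (F j)) :
    ∫ x, ∑ j, DilId.dd j (F j) x = 0 := by
  rw [integral_finsetSum]
  · simp [fun j => (h j).int_dd j]
  · intro j _; exact ((h j).dd j).integrable

lemma temp_coord (j : Fin 3) : (fun x : E => ((x j : ℝ) : ℂ)).HasTemperateGrowth := by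
  have : (fun x : E => ((x j : ℝ) : ℂ)) = 
    (ofRealCLM ∘L (EuclideanSpace.proj j : E →L[ℝ] ℝ)) := by ext x; simp
  rw [this]; exact ContinuousLinearMap.hasTemperateGrowth _

lemma temp_V {V : E → ℝ} (hV : ContDiff ℝ ∞ V)
    (hVbdd : ∀ n : ℕ, ∃ C : ℝ, ∀ x, ‖iteratedFDeriv ℝ n V x‖ ≤ C) :
    (fun x : E => (V x : ℂ)).HasTemperateGrowth := by
  have : V.HasTemperateGrowth := ⟨hV, fun n => by
    obtain ⟨C, hC⟩ := hVbdd n; exact ⟨0, C, by simpa using hC⟩⟩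
  exact Function.HasTemperateGrowth.comp Function.Complex.hasTemperateGrowth_ofReal this

lemma temp_nsq : (fun x : E => ((‖x‖ ^ 2 : ℝ) : ℂ)).HasTemperateGrowth := by
  have : (fun x : E => ((‖x‖ ^ 2 : ℝ) : ℂ)) = fun x : E => ∑ j : Fin 3, ((x j : ℝ) : ℂ) ^ 2 := by
    ext x; rw [EuclideanSpace.norm_sq_eq]; push_cast; simp [← ofReal_pow]
  rw [this]
  exact Function.HasTemperateGrowth.sum fun j _ => (temp_coord j).pow 2

end DilId

namespace DilId
open SchwartzMap Complex

noncomputable def bmp : ContDiffBump (0 : E) := ⟨1, 2, by norm_num, by norm_num⟩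

noncomputable def ct (n : ℕ) (x : E) : ℝ := bmp (((n : ℝ) + 1)⁻¹ • x)

noncomputable def cc (n : ℕ) (x : E) : ℂ := (ct n x : ℂ)

lemma ct_contDiff (n) : ContDiff ℝ ∞ (ct n) :=
  bmp.contDiff.comp (contDiff_const_smul _)

lemma cc_sm (n) : Sm (cc n) := Sm.ofReal (ct_contDiff n)

lemma ct_nonneg (n x) : 0 ≤ ct n x := bmp.nonneg
lemma ct_le_one (n x) : ct n x ≤ 1 := bmp.le_one

lemma ct_one {n : ℕ} {x : E} (h : ‖x‖ ≤ n + 1) : ct n x = 1 := by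
  apply bmp.one_of_mem_closedBall
  have : (0 : ℝ) < n + 1 := by positivity
  rw [mem_closedBall_zero_iff, norm_smul, norm_inv, Real.norm_of_nonneg this.le]
  show _ ≤ (1 : ℝ)
  rw [inv_mul_le_iff₀ this]; simpa using h

lemma ct_compact (n) : HasCompactSupport (ct n) :=
  bmp.hasCompactSupport.comp_smul (by positivity)

lemma cc_compact (n) : HasCompactSupport (cc n) :=
  (ct_compact n).comp_left (g := fun r : ℝ => (r : ℂ)) (by simp)

lemma norm_cc (n x) : ‖cc n x‖ = ct n x := by
  simp [cc, abs_of_nonneg (ct_nonneg n x)]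

lemma dd_compact {f : E → ℂ} (h : HasCompactSupport f) (j) : HasCompactSupport (dd j f) :=
  h.fderiv_apply (𝕜 := ℝ) (ee j)

lemma dd_scale {g : E → ℂ} (hg : Sm g) (a : ℝ) (j) (x) :
    dd j (fun x => g (a • x)) x = a * dd j g (a • x) := by
  unfold dd
  have h1 : HasFDerivAt (fun x : E => a • x) (a • ContinuousLinearMap.id ℝ E) x :=
    (hasFDerivAt_id x).const_smul a
  have := ((hg.diff (a • x)).hasFDerivAt).comp x h1
  have h2 : (fun x => g (a • x)) = g ∘ fun x => a • x := rfl
  rw [h2, this.fderiv]; simp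

noncomputable def c0 (x : E) : ℂ := (bmp x : ℂ)
lemma c0_sm : Sm c0 := Sm.ofReal bmp.contDiff
lemma c0_compact : HasCompactSupport c0 :=
  bmp.hasCompactSupport.comp_left (g := fun r : ℝ => (r : ℂ)) (by simp)

lemma bdd_of_compact {f : E → ℂ} (hf : Continuous f) (h : HasCompactSupport f) :
    ∃ C : ℝ, 0 ≤ C ∧ ∀ x, ‖f x‖ ≤ C := by
  obtain ⟨C, hC⟩ := h.exists_bound_of_continuous hf
  exact ⟨C, (norm_nonneg _).trans (hC 0), hC⟩

lemma cc_eq (n : ℕ) : cc n = fun x => c0 (((n : ℝ) + 1)⁻¹ • x) := rfl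

lemma cut_bounds : ∃ C : ℝ, 1 ≤ C ∧ ∀ (n : ℕ) (j : Fin 3) (x : E),
    ‖dd j (cc n) x‖ ≤ C / (n + 1) ∧ ‖x‖ * ‖dd j (cc n) x‖ ≤ C ∧
    ‖dd j (dd j (cc n)) x‖ ≤ C / (n + 1) := by
  have key : ∀ j : Fin 3, ∃ C : ℝ, 1 ≤ C ∧ ∀ (n : ℕ) (x : E),
    ‖dd j (cc n) x‖ ≤ C / (n + 1) ∧ ‖x‖ * ‖dd j (cc n) x‖ ≤ C ∧
    ‖dd j (dd j (cc n)) x‖ ≤ C / (n + 1) := by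
    intro j
    obtain ⟨C1, h1, hC1⟩ := bdd_of_compact (c0_sm.dd j).cont (dd_compact c0_compact j)
    obtain ⟨C2, h2, hC2⟩ := bdd_of_compact ((c0_sm.dd j).dd j).cont
      (dd_compact (dd_compact c0_compact j) j)
    obtain ⟨C3, h3, hC3⟩ := bdd_of_compact (f := fun x => ((‖x‖ : ℝ) : ℂ) * dd j c0 x)
      (by have := (c0_sm.dd j).cont; fun_prop) ((dd_compact c0_compact j).mul_left)
    refine ⟨1 + C1 + C2 + C3, by linarith, fun n x => ?_⟩
    have hn : (0 : ℝ) < n + 1 := by positivity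
    have e1 : ∀ x, dd j (cc n) x = (((n : ℝ) + 1)⁻¹ : ℝ) * dd j c0 (((n : ℝ) + 1)⁻¹ • x) := by
      intro x; rw [cc_eq, dd_scale c0_sm]
    have e1' : dd j (cc n) = fun x => (((n : ℝ) + 1)⁻¹ : ℝ) * (fun x => dd j c0 (((n : ℝ) + 1)⁻¹ • x)) x :=
      funext e1
    have e2 : dd j (dd j (cc n)) x
        = (((n : ℝ) + 1)⁻¹ : ℝ) * ((((n : ℝ) + 1)⁻¹ : ℝ) * dd j (dd j c0) (((n : ℝ) + 1)⁻¹ • x)) := by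
      rw [e1', dd_const_mul, dd_scale (c0_sm.dd j)]
      exact ContDiff.comp (c0_sm.dd j) (contDiff_const_smul _)
    have hi : ‖((((n : ℝ) + 1)⁻¹ : ℝ) : ℂ)‖ = ((n : ℝ) + 1)⁻¹ := by
      rw [Complex.norm_real, Real.norm_of_nonneg (by positivity)]
    have hi1 : ((n : ℝ) + 1)⁻¹ ≤ 1 := inv_le_one_of_one_le₀ (by linarith [n.cast_nonneg (α := ℝ)])
    have hi0 : 0 ≤ ((n : ℝ) + 1)⁻¹ := by positivity
    refine ⟨?_, ?_, ?_⟩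
    · rw [e1, norm_mul, hi, div_eq_inv_mul]
      gcongr; linarith [hC1 (((n : ℝ) + 1)⁻¹ • x)]
    · have := hC3 (((n : ℝ) + 1)⁻¹ • x)
      rw [norm_mul, Complex.norm_real, norm_norm, norm_smul, Real.norm_of_nonneg hi0] at this
      rw [e1, norm_mul, hi]; nlinarith
    · rw [e2, norm_mul, norm_mul, hi, div_eq_inv_mul]
      gcongr
      have := hC2 (((n : ℝ) + 1)⁻¹ • x)
      nlinarith [norm_nonneg (dd j (dd j c0) (((n : ℝ) + 1)⁻¹ • x))]
  choose C hC1 hC using key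
  refine ⟨C 0 + C 1 + C 2, by linarith [hC1 0, hC1 1, hC1 2], fun n j x => ?_⟩
  have hle : C j ≤ C 0 + C 1 + C 2 := by
    fin_cases j <;> simp <;> linarith [hC1 0, hC1 1, hC1 2]
  obtain ⟨a, b, c⟩ := hC j n x
  have : C j / ((n : ℝ) + 1) ≤ (C 0 + C 1 + C 2) / (n + 1) := by gcongr
  exact ⟨a.trans this, b.trans hle, c.trans this⟩

lemma ct_tendsto (x : E) : Filter.Tendsto (fun n => ct n x) Filter.atTop (nhds 1) := by
  apply tendsto_const_nhds.congr'
  obtain ⟨N, hN⟩ := exists_nat_ge ‖x‖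
  filter_upwards [Filter.eventually_ge_atTop N] with n hn
  rw [ct_one]
  have : (N : ℝ) ≤ n := by exact_mod_cast hn
  linarith

/-- differentiation under the integral sign, compact support in space -/
lemma dInt {φ : E → ℂ} (hφ : Continuous φ) (hc : HasCompactSupport φ) {G : ℝ → E → ℂ}
    (hG : Sm2 G) (t : ℝ) :
    HasDerivAt (fun t => ∫ x, φ x * G t x) (∫ x, φ x * dt G t x) t := by
  have hc1 : Continuous (Function.uncurry G) := ContDiff.continuous hG
  have hc2 : Continuous (Function.uncurry (dt G)) := ContDiff.continuous hG.dt
  have hsl : ∀ t, Continuous (G t) := fun t => (hG.slice t).cont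
  have hsl2 : ∀ t, Continuous (dt G t) := fun t => (hG.dt.slice t).cont
  obtain ⟨C, hC⟩ := ((isCompact_Icc (a := t - 1) (b := t + 1)).prod hc.isCompact).exists_bound_of_continuousOn
    (f := Function.uncurry (dt G)) hc2.continuousOn
  have := hasDerivAt_integral_of_dominated_loc_of_deriv_le (μ := (volume : Measure E)) (𝕜 := ℝ)
    (F := fun t x => φ x * G t x) (F' := fun t x => φ x * dt G t x) (x₀ := t)
    (s := Set.Icc (t-1) (t+1)) (bound := fun x => ‖φ x‖ * C)
    (Icc_mem_nhds (by linarith) (by linarith))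
    (Filter.Eventually.of_forall fun s => (hφ.mul (hsl s)).aestronglyMeasurable)
    ((hφ.mul (hsl t)).integrable_of_hasCompactSupport hc.mul_right)
    ((hφ.mul (hsl2 t)).aestronglyMeasurable)
    (Filter.Eventually.of_forall fun x s hs => by
      rw [norm_mul]
      by_cases hx : x ∈ tsupport φ
      · gcongr; exact hC (s, x) ⟨hs, hx⟩
      · rw [image_eq_zero_of_notMem_tsupport hx]; simp)
    (((hφ.norm).mul continuous_const).integrable_of_hasCompactSupport (hc.norm.mul_right))
    (Filter.Eventually.of_forall fun x s hs => (hG.hasDeriv s x).const_mul _)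
  exact this.2

end DilId

namespace DilId
open SchwartzMap Complex

lemma Sm.cmpInt {φ g : E → ℂ} (hφ : Continuous φ) (hc : HasCompactSupport φ) (hg : Continuous g) :
    Integrable (fun x => φ x * g x) :=
  (hφ.mul hg).integrable_of_hasCompactSupport hc.mul_right

lemma Sm.sum {f : Fin 3 → E → ℂ} (h : ∀ j, Sm (f j)) : Sm (fun x => ∑ j, f j x) :=
  ContDiff.sum fun j _ => h j

lemma sum_cmp {f : Fin 3 → E → ℂ} (h : ∀ j, HasCompactSupport (f j)) :
    HasCompactSupport (fun x => ∑ j, f j x) := by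
  simp only [Fin.sum_univ_three]
  exact ((h 0).add (h 1)).add (h 2)

lemma flux1 {φ q v : E → ℂ} (hφ : Sm φ) (hc : HasCompactSupport φ) (hq : Sm q) (hv : Sm v) :
    ∫ x, φ x * (q x * lap v x - v x * lap q x) =
      - ∫ x, ∑ j, dd j φ x * (q x * dd j v x - v x * dd j q x) := by
  have h0 := Sch.int_div (F := fun j x => φ x * (q x * dd j v x - v x * dd j q x))
    (fun j => Sch.of_compact (hφ.mul ((hq.mul (hv.dd j)).sub (hv.mul (hq.dd j)))) hc.mul_right)
  have h1 : ∀ x, ∑ j, dd j (fun x => φ x * (q x * dd j v x - v x * dd j q x)) x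
     = φ x * (q x * lap v x - v x * lap q x)
        + ∑ j, dd j φ x * (q x * dd j v x - v x * dd j q x) := by
    intro x
    have : ∀ j, dd j (fun x => φ x * (q x * dd j v x - v x * dd j q x)) x
      = dd j φ x * (q x * dd j v x - v x * dd j q x) +
        φ x * (q x * dd j (dd j v) x - v x * dd j (dd j q) x) := by
      intro j
      rw [dd_mul hφ ((hq.mul (hv.dd j)).sub (hv.mul (hq.dd j))),
        dd_sub (hq.mul (hv.dd j)) (hv.mul (hq.dd j)), dd_mul hq (hv.dd j), dd_mul hv (hq.dd j)]
      ring
    simp only [this, lap, Fin.sum_univ_three]; ring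
  simp only [h1] at h0
  rw [integral_add] at h0
  · exact eq_neg_of_add_eq_zero_left h0
  · exact Sm.cmpInt hφ.cont hc ((hq.mul hv.lap).sub (hv.mul hq.lap)).cont
  · exact integrable_finsetSum _ fun j _ => Sm.cmpInt (hφ.dd j).cont (dd_compact hc j)
      ((hq.mul (hv.dd j)).sub (hv.mul (hq.dd j))).cont

lemma flux2 {φ q v : E → ℂ} (hφ : Sm φ) (hc : HasCompactSupport φ) (hq : Sm q) (hv : Sm v) :
    ∫ x, φ x * (q x * lap v x - v x * lap q x) =
      - ∫ x, ∑ j, (2 * dd j φ x * (q x * dd j v x) + dd j (dd j φ) x * (q x * v x)) := by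
  rw [flux1 hφ hc hq hv]
  have h0 := Sch.int_div (F := fun j x => dd j φ x * (q x * v x))
    (fun j => Sch.of_compact ((hφ.dd j).mul (hq.mul hv)) (dd_compact hc j).mul_right)
  have h1 : ∀ x, ∑ j, dd j (fun x => dd j φ x * (q x * v x)) x
     = (∑ j, (2 * dd j φ x * (q x * dd j v x) + dd j (dd j φ) x * (q x * v x)))
        - ∑ j, dd j φ x * (q x * dd j v x - v x * dd j q x) := by
    intro x
    have : ∀ j, dd j (fun x => dd j φ x * (q x * v x)) x
      = (2 * dd j φ x * (q x * dd j v x) + dd j (dd j φ) x * (q x * v x))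
        - dd j φ x * (q x * dd j v x - v x * dd j q x) := by
      intro j
      rw [dd_mul (hφ.dd j) (hq.mul hv), dd_mul hq hv]
      ring
    simp only [this, Fin.sum_univ_three]; ring
  simp only [h1] at h0
  rw [integral_sub] at h0
  · rw [sub_eq_zero.1 h0]
  · refine integrable_finsetSum _ fun j _ => Integrable.add ?_ ?_
    · simp only [mul_assoc]
      exact (Sm.cmpInt (hφ.dd j).cont (dd_compact hc j) (hq.mul (hv.dd j)).cont).const_mul 2
    · exact Sm.cmpInt ((hφ.dd j).dd j).cont (dd_compact (dd_compact hc j) j) (hq.mul hv).cont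
  · exact integrable_finsetSum _ fun j _ => Sm.cmpInt (hφ.dd j).cont (dd_compact hc j)
      ((hq.mul (hv.dd j)).sub (hv.mul (hq.dd j))).cont

/-- squared cutoff -/
noncomputable def c2 (n : ℕ) (x : E) : ℂ := cc n x * cc n x
lemma c2_sm (n) : Sm (c2 n) := (cc_sm n).mul (cc_sm n)
lemma c2_compact (n) : HasCompactSupport (c2 n) := (cc_compact n).mul_right
lemma dd_c2 (n j x) : dd j (c2 n) x = 2 * cc n x * dd j (cc n) x := by
  unfold c2; rw [dd_mul (cc_sm n) (cc_sm n)]; ring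
lemma dd_dd_c2 (n j x) : dd j (dd j (c2 n)) x
    = 2 * (dd j (cc n) x) ^ 2 + 2 * cc n x * dd j (dd j (cc n)) x := by
  have : dd j (c2 n) = fun x => (2 * cc n x) * dd j (cc n) x := funext (dd_c2 n j)
  rw [this, dd_mul ((Sm.const 2).mul (cc_sm n)) ((cc_sm n).dd j), dd_const_mul 2 (cc_sm n)]; ring

noncomputable def gr (v : E → ℂ) (x : E) : ℝ := ∑ j, ‖dd j v x‖ ^ 2

lemma gr_cont {v : E → ℂ} (hv : Sm v) : Continuous (gr v) :=
  continuous_finsetSum _ fun j _ => ((hv.dd j).cont.norm.pow 2)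

lemma gr_nonneg (v x) : 0 ≤ gr v x := Finset.sum_nonneg fun j _ => by positivity

lemma ct_int (n) {g : E → ℝ} (hg : Continuous g) : Integrable (fun x => ct n x ^ 2 * g x) := by
  have h1 : HasCompactSupport (fun x => ct n x ^ 2) :=
    (ct_compact n).comp_left (g := fun r : ℝ => r ^ 2) (by simp)
  exact (((ct_contDiff n).continuous.pow 2).mul hg).integrable_of_hasCompactSupport h1.mul_right

lemma cacc : ∃ K : ℝ, 0 ≤ K ∧ ∀ (n : ℕ) (v : E → ℂ), Sm v →
    Integrable (fun x => ‖v x‖ ^ 2) → Integrable (fun x => ‖lap v x‖ ^ 2) →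
    ∫ x, ct n x ^ 2 * gr v x ≤ K * ((∫ x, ‖v x‖ ^ 2) + ∫ x, ‖lap v x‖ ^ 2) := by
  obtain ⟨C, hC1, hC⟩ := cut_bounds
  refine ⟨1 + 12 * C ^ 2, by positivity, fun n v hv i1 i2 => ?_⟩
  have hw := hv.conj
  have h0 := Sch.int_div (F := fun j x => c2 n x * ((starRingEnd ℂ) (v x) * dd j v x))
    (fun j => Sch.of_compact ((c2_sm n).mul (hw.mul (hv.dd j))) (c2_compact n).mul_right)
  have h1 : ∀ x, ∑ j, dd j (fun x => c2 n x * ((starRingEnd ℂ) (v x) * dd j v x)) x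
     = ((ct n x ^ 2 * gr v x : ℝ) : ℂ) + (c2 n x * ((starRingEnd ℂ) (v x) * lap v x)
        + ∑ j, dd j (c2 n) x * ((starRingEnd ℂ) (v x) * dd j v x)) := by
    intro x
    have : ∀ j, dd j (fun x => c2 n x * ((starRingEnd ℂ) (v x) * dd j v x)) x
      = dd j (c2 n) x * ((starRingEnd ℂ) (v x) * dd j v x) +
        c2 n x * (((‖dd j v x‖ : ℝ) : ℂ) ^ 2  + (starRingEnd ℂ) (v x) * dd j (dd j v) x) := by
      intro j
      rw [dd_mul (c2_sm n) (hw.mul (hv.dd j)), dd_mul hw (hv.dd j), dd_conj, ← conj_mul']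
    simp only [this]
    simp only [lap, gr, Fin.sum_univ_three, c2, cc]; push_cast; ring
  simp only [h1] at h0
  have hi1 : Integrable (fun x => ((ct n x ^ 2 * gr v x : ℝ) : ℂ)) := (ct_int n (gr_cont hv)).ofReal
  have hi2 : Integrable (fun x => (c2 n x * ((starRingEnd ℂ) (v x) * lap v x)
        + ∑ j, dd j (c2 n) x * ((starRingEnd ℂ) (v x) * dd j v x))) := by
    refine Integrable.add ?_ ?_
    · exact Sm.cmpInt (c2_sm n).cont (c2_compact n) (hw.mul hv.lap).cont
    · exact integrable_finsetSum _ fun j _ => Sm.cmpInt ((c2_sm n).dd j).cont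
        (dd_compact (c2_compact n) j) (hw.mul (hv.dd j)).cont
  rw [integral_add hi1 hi2, integral_complex_ofReal] at h0
  have hX0 : 0 ≤ ∫ x, ct n x ^ 2 * gr v x :=
    integral_nonneg fun x => mul_nonneg (sq_nonneg _) (gr_nonneg v x)
  have h2 := norm_integral_le_of_norm_le (f := fun x => (c2 n x * ((starRingEnd ℂ) (v x) * lap v x)
        + ∑ j, dd j (c2 n) x * ((starRingEnd ℂ) (v x) * dd j v x)))
      (g := fun x => (1/2 + 6 * C^2) * ‖v x‖ ^ 2 + 1/2 * ‖lap v x‖ ^ 2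
        + 1/2 * (ct n x ^ 2 * gr v x))
      (((i1.const_mul _).add (i2.const_mul _)).add ((ct_int n (gr_cont hv)).const_mul _))
      (Filter.Eventually.of_forall fun x => by
        have a0 := ct_nonneg n x
        have a1 := ct_le_one n x
        have b1 : ‖c2 n x * ((starRingEnd ℂ) (v x) * lap v x)‖
            ≤ 1/2 * ‖v x‖ ^ 2 + 1/2 * ‖lap v x‖ ^ 2 := by
          rw [norm_mul, norm_mul, c2, norm_mul, norm_cc, RCLike.norm_conj]
          have : ct n x * ct n x ≤ 1 := by nlinarith
          have p : 0 ≤ ‖v x‖ * ‖lap v x‖ := by positivity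
          nlinarith [sq_nonneg (‖v x‖ - ‖lap v x‖)]
        have b2 : ∀ j, ‖dd j (c2 n) x * ((starRingEnd ℂ) (v x) * dd j v x)‖
            ≤ 2 * C^2 * ‖v x‖ ^ 2 + 1/2 * (ct n x ^ 2 * ‖dd j v x‖ ^ 2) := by
          intro j
          rw [dd_c2]
          simp only [norm_mul, norm_cc, RCLike.norm_conj]
          have hb : ‖dd j (cc n) x‖ ≤ C := (hC n j x).1.trans
            (div_le_self (by linarith) (by linarith [n.cast_nonneg (α := ℝ)]))
          have p : 0 ≤ ct n x * ‖v x‖ * ‖dd j v x‖ := by positivity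
          have : ‖(2:ℂ)‖ = 2 := by simp
          rw [this]
          nlinarith [sq_nonneg (2 * C * ‖v x‖ - ct n x * ‖dd j v x‖)]
        refine (norm_add_le _ _).trans ((add_le_add b1 ((norm_sum_le _ _).trans
          (Finset.sum_le_sum fun j _ => b2 j))).trans (le_of_eq ?_))
        simp only [gr, Fin.sum_univ_three]; ring)
  have h3 := eq_neg_of_add_eq_zero_left h0
  have h4 : ∫ x, ct n x ^ 2 * gr v x = ‖∫ x, (c2 n x * ((starRingEnd ℂ) (v x) * lap v x)
        + ∑ j, dd j (c2 n) x * ((starRingEnd ℂ) (v x) * dd j v x))‖ := by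
    rw [← norm_neg, ← h3, Complex.norm_real, Real.norm_of_nonneg hX0]
  have i12 : Integrable (fun x => (1/2 + 6 * C^2) * ‖v x‖ ^ 2 + 1/2 * ‖lap v x‖ ^ 2) :=
    (i1.const_mul _).add (i2.const_mul _)
  rw [← h4, integral_add i12 ((ct_int n (gr_cont hv)).const_mul _),
    integral_add (i1.const_mul _) (i2.const_mul _), integral_const_mul, integral_const_mul,
    integral_const_mul] at h2
  have j1 : 0 ≤ ∫ x, ‖v x‖ ^ 2 := integral_nonneg fun x => by positivity
  have j2 : 0 ≤ ∫ x, ‖lap v x‖ ^ 2 := integral_nonneg fun x => by positivity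
  nlinarith [mul_nonneg (sq_nonneg C) j2]

lemma flux_bound : ∃ K : ℝ, 0 ≤ K ∧ ∀ (n : ℕ) (q v : E → ℂ), Sm q → Sm v →
    Integrable (fun x => ‖q x‖ ^ 2) → Integrable (fun x => ‖v x‖ ^ 2) →
    ‖∫ x, c2 n x * (q x * lap v x - v x * lap q x)‖ ≤
      K / (n + 1) * ((∫ x, ‖q x‖ ^ 2) + (∫ x, ‖v x‖ ^ 2) + ∫ x, ct n x ^ 2 * gr v x) := by
  obtain ⟨C, hC1, hC⟩ := cut_bounds
  refine ⟨12 * C ^ 2, by positivity, fun n q v hq hv i1 i2 => ?_⟩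
  have hn : (0 : ℝ) < n + 1 := by positivity
  rw [flux2 (c2_sm n) (c2_compact n) hq hv, norm_neg]
  have i3 := ct_int n (gr_cont hv)
  have i12 : Integrable (fun x => ‖q x‖ ^ 2 + ‖v x‖ ^ 2) := i1.add i2
  rw [← integral_add i1 i2, ← integral_add i12 i3, ← integral_const_mul]
  refine norm_integral_le_of_norm_le ((i12.add i3).const_mul _)
    (Filter.Eventually.of_forall fun x => ?_)
  have a0 := ct_nonneg n x
  have a1 := ct_le_one n x
  have hCn : C / (n + 1) ≤ C :=
    div_le_self (by linarith) (by linarith [n.cast_nonneg (α := ℝ)])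
  have hC0 : 0 ≤ C / (n + 1) := by positivity
  have b : ∀ j, ‖2 * dd j (c2 n) x * (q x * dd j v x) + dd j (dd j (c2 n)) x * (q x * v x)‖
     ≤ C / (n+1) * C * (4 * ‖q x‖ ^ 2 + 2 * ‖v x‖ ^ 2 + 2 * (ct n x ^ 2 * ‖dd j v x‖ ^ 2)) := by
    intro j
    obtain ⟨k1, -, k3⟩ := hC n j x
    rw [dd_c2, dd_dd_c2]
    have two : ‖(2:ℂ)‖ = 2 := by simp
    have m1 : ‖2 * (2 * cc n x * dd j (cc n) x) * (q x * dd j v x)‖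
       ≤ C / (n + 1) * (2 * ‖q x‖ ^ 2 + 2 * (ct n x ^ 2 * ‖dd j v x‖ ^ 2)) := by
      simp only [norm_mul, norm_cc, two]
      have p : 0 ≤ ct n x * ‖q x‖ * ‖dd j v x‖ := by positivity
      have := mul_le_mul_of_nonneg_right k1 p
      nlinarith [mul_nonneg hC0 (sq_nonneg (‖q x‖ - ct n x * ‖dd j v x‖))]
    have m2 : ‖(2 * (dd j (cc n) x) ^ 2 + 2 * cc n x * dd j (dd j (cc n)) x) * (q x * v x)‖
       ≤ C / (n + 1) * C * (2 * ‖q x‖ ^ 2 + 2 * ‖v x‖ ^ 2) := by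
      rw [norm_mul, norm_mul]
      have s1 : ‖2 * (dd j (cc n) x) ^ 2 + 2 * cc n x * dd j (dd j (cc n)) x‖ ≤ 4 * (C / (n+1) * C) := by
        refine (norm_add_le _ _).trans ?_
        simp only [norm_mul, norm_pow, norm_cc, two]
        have r1 : ‖dd j (cc n) x‖ ^ 2 ≤ C / (n+1) * C := by
          rw [pow_two]; exact mul_le_mul k1 (k1.trans hCn) (norm_nonneg _) hC0
        have r2 : ct n x * ‖dd j (dd j (cc n)) x‖ ≤ C / (n+1) * C := by
          calc _ ≤ 1 * (C / (n+1)) := by gcongr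
            _ ≤ _ := by nlinarith
        nlinarith
      have p : 0 ≤ ‖q x‖ * ‖v x‖ := by positivity
      have := mul_le_mul_of_nonneg_right s1 p
      have pc : 0 ≤ C / (n+1) * C := by positivity
      nlinarith [mul_nonneg pc (sq_nonneg (‖q x‖ - ‖v x‖))]
    refine (norm_add_le _ _).trans ?_
    have : C / (n + 1) * (2 * ‖q x‖ ^ 2 + 2 * (ct n x ^ 2 * ‖dd j v x‖ ^ 2))
       ≤ C / (n + 1) * C * (2 * ‖q x‖ ^ 2 + 2 * (ct n x ^ 2 * ‖dd j v x‖ ^ 2)) := by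
      have p : 0 ≤ C / (n + 1) * (2 * ‖q x‖ ^ 2 + 2 * (ct n x ^ 2 * ‖dd j v x‖ ^ 2)) := by positivity
      nlinarith
    nlinarith
  refine (norm_sum_le _ _).trans ((Finset.sum_le_sum fun j _ => b j).trans ?_)
  have e : 12 * C ^ 2 / (n + 1) = 12 * (C / (n+1) * C) := by ring
  have pc : 0 ≤ C / (n+1) * C := by positivity
  simp only [e, gr, Fin.sum_univ_three, Pi.add_apply]
  have z : 0 ≤ ‖v x‖ ^ 2 := by positivity
  have z' : ∀ j, 0 ≤ ct n x ^ 2 * ‖dd j v x‖ ^ 2 := fun j => by positivity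
  nlinarith [mul_nonneg pc z, mul_nonneg pc (z' 0), mul_nonneg pc (z' 1), mul_nonneg pc (z' 2)]

end DilId

namespace DilId
open SchwartzMap Complex

lemma Sm2.mul {u v : ℝ → E → ℂ} (h : Sm2 u) (h' : Sm2 v) : Sm2 (fun t x => u t x * v t x) :=
  ContDiff.mul h h'
lemma Sm2.sub {u v : ℝ → E → ℂ} (h : Sm2 u) (h' : Sm2 v) : Sm2 (fun t x => u t x - v t x) :=
  ContDiff.sub h h'
lemma Sm2.conj {u : ℝ → E → ℂ} (h : Sm2 u) : Sm2 (fun t x => (starRingEnd ℂ) (u t x)) :=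
  (conjCLE.contDiff).comp h
lemma Sm2.shift {u : ℝ → E → ℂ} (h : Sm2 u) (s : ℝ) : Sm2 (fun t x => u (t + s) x) :=
  ContDiff.comp h ((contDiff_fst.add contDiff_const).prodMk contDiff_snd)
lemma Sm2.constT {f : E → ℂ} (h : Sm f) : Sm2 (fun _ x => f x) :=
  ContDiff.comp h contDiff_snd

lemma dt_mul {u v : ℝ → E → ℂ} (h : Sm2 u) (h' : Sm2 v) (t x) :
    dt (fun t x => u t x * v t x) t x = dt u t x * v t x + u t x * dt v t x :=
  ((h.hasDeriv t x).mul (h'.hasDeriv t x)).deriv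
lemma dt_sub {u v : ℝ → E → ℂ} (h : Sm2 u) (h' : Sm2 v) (t x) :
    dt (fun t x => u t x - v t x) t x = dt u t x - dt v t x :=
  ((h.hasDeriv t x).sub (h'.hasDeriv t x)).deriv
lemma dt_conj {u : ℝ → E → ℂ} (h : Sm2 u) (t x) :
    dt (fun t x => (starRingEnd ℂ) (u t x)) t x = (starRingEnd ℂ) (dt u t x) := by
  have := ((conjCLE.hasFDerivAt (x := u t x)).comp_hasDerivAt t (h.hasDeriv t x)).deriv
  exact this
lemma dt_shift {u : ℝ → E → ℂ} (h : Sm2 u) (s t x) :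
    dt (fun t x => u (t + s) x) t x = dt u (t + s) x := by
  have := ((h.hasDeriv (t + s) x).comp_add_const t s).deriv
  exact this
lemma dt_constT (f : E → ℂ) (t x) : dt (fun _ x => f x) t x = 0 := by
  simp [dt]

lemma yder {φ : E → ℝ} (hφ : Continuous φ) (hc : HasCompactSupport φ) {w : ℝ → E → ℂ}
    (hw : Sm2 w) (t : ℝ) :
    HasDerivAt (fun t => ∫ x, φ x * ‖w t x‖ ^ 2)
      (∫ x, φ x * (2 * ((starRingEnd ℂ) (w t x) * dt w t x).re)) t := by
  have hφ' : Continuous (fun x => (φ x : ℂ)) := continuous_ofReal.comp hφ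
  have hc' : HasCompactSupport (fun x => (φ x : ℂ)) := hc.comp_left (g := fun r : ℝ => (r : ℂ)) (by simp)
  have h0 := dInt hφ' hc' (hw.conj.mul hw) t
  have h1 := (reCLM.hasFDerivAt (x := ∫ x, (φ x : ℂ) * ((starRingEnd ℂ) (w t x) * w t x))).comp_hasDerivAt t h0
  have hi : Integrable (fun x => (φ x : ℂ) * dt (fun t x => (starRingEnd ℂ) (w t x) * w t x) t x) :=
    Sm.cmpInt hφ' hc' ((hw.conj.mul hw).dt.slice t).cont
  have e2 : ∀ x, reCLM ((φ x : ℂ) * dt (fun t x => (starRingEnd ℂ) (w t x) * w t x) t x)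
     = φ x * (2 * ((starRingEnd ℂ) (w t x) * dt w t x).re) := by
    intro x
    rw [dt_mul hw.conj hw, dt_conj hw]
    simp only [reCLM_apply, mul_re, add_re, conj_re, conj_im, ofReal_re, ofReal_im, mul_im, add_im]; ring
  rw [← ContinuousLinearMap.integral_comp_comm _ hi] at h1
  simp only [e2] at h1
  refine h1.congr_of_eventuallyEq (Filter.Eventually.of_forall fun s => ?_)
  have hi2 : Integrable (fun x => (φ x : ℂ) * ((starRingEnd ℂ) (w s x) * w s x)) :=
    Sm.cmpInt hφ' hc' ((hw.conj.mul hw).slice s).cont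
  show _ = reCLM (∫ x, (φ x : ℂ) * ((starRingEnd ℂ) (w s x) * w s x))
  rw [← ContinuousLinearMap.integral_comp_comm _ hi2]
  refine integral_congr_ae (Filter.Eventually.of_forall fun x => ?_)
  simp only []
  rw [conj_mul', ← ofReal_pow, ← ofReal_mul, reCLM_apply, ofReal_re]

lemma gron {y y' : ℝ → ℝ} {a b A B : ℝ} (hA : 0 < A)
    (h : ∀ t ∈ Set.Icc a b, HasDerivAt y (y' t) t)
    (h' : ∀ t ∈ Set.Icc a b, y' t ≤ A * y t + B) :
    ∀ t ∈ Set.Icc a b, y t ≤ (y a + B / A) * Real.exp (A * (t - a)) - B / A := by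
  intro t ht
  have hd : ∀ s ∈ Set.Icc a b, HasDerivAt (fun s => (y s + B / A) * Real.exp (-(A * (s - a))))
      (y' s * Real.exp (-(A * (s - a))) + (y s + B / A) * (Real.exp (-(A * (s - a))) * (-A))) s := by
    intro s hs
    have h1 : HasDerivAt (fun s => -(A * (s - a))) (-A) s := by
      have h2 := (((hasDerivAt_id s).sub_const a).const_mul A).neg
      rw [mul_one] at h2
      exact h2
    exact ((h s hs).add_const _).mul h1.exp
  have anti : AntitoneOn (fun s => (y s + B / A) * Real.exp (-(A * (s - a)))) (Set.Icc a b) := by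
    apply antitoneOn_of_deriv_nonpos (convex_Icc a b)
    · exact fun s hs => (hd s hs).continuousAt.continuousWithinAt
    · exact fun s hs => (hd s (interior_subset hs)).differentiableAt.differentiableWithinAt
    · intro s hs
      rw [(hd s (interior_subset hs)).deriv]
      have := h' s (interior_subset hs)
      have e : y' s * Real.exp (-(A * (s - a))) + (y s + B / A) * (Real.exp (-(A * (s - a))) * (-A))
        = (y' s - (A * y s + B)) * Real.exp (-(A * (s - a))) := by field_simp; ring
      rw [e]
      exact mul_nonpos_of_nonpos_of_nonneg (by linarith) (Real.exp_pos _).le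
  have := anti ⟨le_refl a, ht.1.trans ht.2⟩ ht ht.1
  simp only [sub_self, mul_zero, neg_zero, Real.exp_zero, mul_one] at this
  rw [Real.exp_neg] at this
  have hp := Real.exp_pos (A * (t - a))
  rw [← div_eq_mul_inv, div_le_iff₀ hp] at this
  linarith

lemma Sch.sq {f : E → ℂ} (h : Sch f) : Integrable (fun x => ‖f x‖ ^ 2) := by
  have := (h.mul h).integrable.norm
  simpa [norm_mul, pow_two] using this

lemma ct_le_int (n) {f : E → ℝ} (hf : Integrable f) (hfc : Continuous f) (h0 : ∀ x, 0 ≤ f x) :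
    ∫ x, ct n x ^ 2 * f x ≤ ∫ x, f x := by
  refine integral_mono (ct_int n hfc) hf fun x => ?_
  have : ct n x ^ 2 ≤ 1 := pow_le_one₀ (ct_nonneg n x) (ct_le_one n x)
  exact mul_le_of_le_one_left (h0 x) this

lemma c2_norm_le (n x) : ‖c2 n x‖ ≤ 1 := by
  rw [c2, norm_mul, norm_cc]
  nlinarith [ct_nonneg n x, ct_le_one n x]

lemma ct_lim {f : E → ℂ} (hf : Integrable f) :
    Filter.Tendsto (fun n => ∫ x, c2 n x * f x) Filter.atTop (nhds (∫ x, f x)) := by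
  refine tendsto_integral_of_dominated_convergence (fun x => ‖f x‖) ?_ hf.norm ?_ ?_
  · exact fun n => (c2_sm n).cont.aestronglyMeasurable.mul hf.1
  · intro n
    refine Filter.Eventually.of_forall fun x => ?_
    rw [norm_mul]
    exact mul_le_of_le_one_left (norm_nonneg _) (c2_norm_le n x)
  · refine Filter.Eventually.of_forall fun x => ?_
    have h1 : Filter.Tendsto (fun n => c2 n x) Filter.atTop (nhds 1) := by
      have := (continuous_ofReal.tendsto _).comp (ct_tendsto x)
      have h2 := this.mul this
      simpa [c2, cc] using h2
    simpa using h1.mul_const (f x)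

lemma ct_lim_real {f : E → ℝ} (hf : Integrable f) :
    Filter.Tendsto (fun n => ∫ x, ct n x ^ 2 * f x) Filter.atTop (nhds (∫ x, f x)) := by
  refine tendsto_integral_of_dominated_convergence (fun x => ‖f x‖) ?_ hf.norm ?_ ?_
  · exact fun n => ((ct_contDiff n).continuous.pow 2).aestronglyMeasurable.mul hf.1
  · intro n
    refine Filter.Eventually.of_forall fun x => ?_
    rw [norm_mul, norm_pow, Real.norm_of_nonneg (ct_nonneg n x)]
    exact mul_le_of_le_one_left (norm_nonneg _) (pow_le_one₀ (ct_nonneg n x) (ct_le_one n x))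
  · refine Filter.Eventually.of_forall fun x => ?_
    simpa using ((ct_tendsto x).pow 2).mul_const (f x)

lemma ct2_cont (n) : Continuous (fun x => ct n x ^ 2) := (ct_contDiff n).continuous.pow 2
lemma ct2_compact (n) : HasCompactSupport (fun x => ct n x ^ 2) :=
    (ct_compact n).comp_left (g := fun r : ℝ => r ^ 2) (by simp)

lemma re_amgm (z w : ℂ) {δ : ℝ} (hδ : 0 < δ) :
    2 * ((starRingEnd ℂ) z * w).re ≤ 1 / δ * ‖z‖ ^ 2 + δ * ‖w‖ ^ 2 := by
  have h1 : ((starRingEnd ℂ) z * w).re ≤ ‖z‖ * ‖w‖ := by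
    refine (re_le_norm _).trans ?_
    rw [norm_mul, RCLike.norm_conj]
  have h2 : 1 / δ * ‖z‖ ^ 2 + δ * ‖w‖ ^ 2 - 2 * (‖z‖ * ‖w‖) = 1 / δ * (‖z‖ - δ * ‖w‖) ^ 2 := by
    field_simp; ring
  have h3 : 0 ≤ 1 / δ * (‖z‖ - δ * ‖w‖) ^ 2 := by positivity
  linarith

lemma diffL2 {w : ℝ → E → ℂ} (hw : Sm2 w) {a b N₀ : ℝ}
    (hi : ∀ t ∈ Set.Icc a b, Integrable (fun x => ‖dt w t x‖ ^ 2))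
    (hN : ∀ t ∈ Set.Icc a b, ∫ x, ‖dt w t x‖ ^ 2 ≤ N₀) {t h : ℝ} (ht : a ≤ t) (hh : 0 < h)
    (hth : t + h ≤ b) (n : ℕ) :
    ∫ x, ct n x ^ 2 * ‖w (t + h) x - w t x‖ ^ 2 ≤ 2 * h ^ 2 * N₀ := by
  have hN0 : 0 ≤ N₀ := (integral_nonneg fun x => by positivity).trans (hN t ⟨ht, by linarith⟩)
  have hs := (hw.shift t)
  have hz : Sm2 (fun r x => w (r + t) x - w t x) := hs.sub (Sm2.constT (hw.slice t))
  have hdz : ∀ r x, dt (fun r x => w (r + t) x - w t x) r x = dt w (r + t) x := by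
    intro r x
    rw [dt_sub hs (Sm2.constT (hw.slice t)), dt_shift hw, dt_constT, sub_zero]
  have hd := fun r => yder (ct2_cont n) (ct2_compact n) hz r
  simp only [hdz] at hd
  have key := gron (y := fun r => ∫ x, ct n x ^ 2 * ‖w (r + t) x - w t x‖ ^ 2)
    (a := 0) (b := h) (A := 1 / h) (B := h * N₀) (by positivity) (fun r _ => hd r)
    (fun r hr => by
      have hm : r + t ∈ Set.Icc a b := ⟨by linarith [hr.1], by linarith [hr.2]⟩
      have hc1 : Continuous (fun x => ‖w (r + t) x - w t x‖ ^ 2) := (hz.slice r).cont.norm.pow 2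
      have hc2 : Continuous (fun x => ‖dt w (r + t) x‖ ^ 2) := (hw.dt.slice _).cont.norm.pow 2
      have hc3 : Continuous (fun x => 2 * ((starRingEnd ℂ) (w (r + t) x - w t x) * dt w (r + t) x).re) :=
        continuous_const.mul (continuous_re.comp ((hz.slice r).conj.cont.mul (hw.dt.slice _).cont))
      have i1 := ct_int n hc1
      have i2 := ct_int n hc2
      have i3 := ct_int n hc3
      have m := integral_mono (μ := volume) i3 ((i1.const_mul (1/h)).add (i2.const_mul h)) (fun x => by
        have := mul_le_mul_of_nonneg_left (re_amgm (w (r + t) x - w t x) (dt w (r + t) x) hh)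
          (sq_nonneg (ct n x))
        simp only [Pi.add_apply]
        linarith)
      simp only [Pi.add_apply] at m
      rw [integral_add (i1.const_mul (1/h)) (i2.const_mul h), integral_const_mul,
        integral_const_mul] at m
      have m2 := (ct_le_int n (hi _ hm) hc2 (fun x => by positivity)).trans (hN _ hm)
      have := mul_le_mul_of_nonneg_left m2 hh.le
      linarith) h ⟨hh.le, le_refl h⟩
  have e0 : ∫ x, ct n x ^ 2 * ‖w (0 + t) x - w t x‖ ^ 2 = 0 := by simp
  simp only [e0] at key
  have e1 : h * N₀ / (1 / h) = h ^ 2 * N₀ := by field_simp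
  have e2 : 1 / h * (h - 0) = 1 := by field_simp; ring
  rw [e1, e2, add_comm h t] at key
  have := Real.exp_one_lt_d9
  have p : 0 ≤ h ^ 2 * N₀ := by positivity
  nlinarith

end DilId

namespace DilId
open SchwartzMap Complex

structure Hyp (V : E → ℝ) (w : ℝ → E → ℂ) : Prop where
  sol : Sol V w
  s0 : ∀ t, Sch (w t)
  s1 : ∀ t, Sch (dt w t)

lemma Hyp.diff {V : E → ℝ} {w : ℝ → E → ℂ} (hw : Hyp V w) (h : ℝ) :
    Sol V (fun t x => w (t + h) x - w t x) := by
  refine ⟨(hw.sol.sm.shift h).sub hw.sol.sm, fun t x => ?_⟩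
  rw [dt_sub (hw.sol.sm.shift h) hw.sol.sm, dt_shift hw.sol.sm,
    lap_sub (hw.sol.sm.slice _) (hw.sol.sm.slice _), hw.sol.eq, hw.sol.eq]
  ring

lemma Hyp.L2 {V : E → ℝ} {w : ℝ → E → ℂ} (hw : Hyp V w) {a b N₀ : ℝ}
    (hN : ∀ t ∈ Set.Icc a b, ∫ x, ‖dt w t x‖ ^ 2 ≤ N₀) {t h : ℝ} (ht : a ≤ t) (hh : 0 < h)
    (hth : t + h ≤ b) :
    ∫ x, ‖w (t + h) x - w t x‖ ^ 2 ≤ 2 * h ^ 2 * N₀ :=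
  le_of_tendsto' (ct_lim_real ((hw.s0 (t+h)).sub (hw.s0 t)).sq) fun n =>
    diffL2 hw.sol.sm (fun t _ => (hw.s1 t).sq) hN ht hh hth n

lemma norm_sub_sq_le (z w : ℂ) : ‖z - w‖ ^ 2 ≤ 2 * ‖z‖ ^ 2 + 2 * ‖w‖ ^ 2 := by
  have := norm_sub_le z w
  have h := norm_nonneg (z - w)
  nlinarith [sq_nonneg (‖z‖ - ‖w‖)]

lemma lap_L2 {V : E → ℝ} {B : ℝ} (hB : ∀ x, |V x| ≤ B) {u : ℝ → E → ℂ} (hu : Sol V u) (t x) :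
    ‖lap (u t) x‖ ^ 2 ≤ 2 * ‖dt u t x‖ ^ 2 + 2 * B ^ 2 * ‖u t x‖ ^ 2 := by
  have e : lap (u t) x = (-I) * dt u t x - (-(V x * u t x)) := by
    rw [hu.eq]; linear_combination ((lap (u t) x) - V x * u t x) * I_sq
  rw [e]
  refine (norm_sub_sq_le _ _).trans ?_
  rw [norm_neg, norm_mul, norm_mul, norm_neg, norm_I, one_mul, Complex.norm_real, mul_pow, Real.norm_eq_abs]
  have : |V x| ^ 2 ≤ B ^ 2 := pow_le_pow_left₀ (abs_nonneg _) (hB x) 2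
  nlinarith [mul_le_mul_of_nonneg_right this (sq_nonneg ‖u t x‖)]

/-- uniform gradient bound from Caccioppoli -/
lemma gr_bound {V : E → ℝ} {B : ℝ} (hB : ∀ x, |V x| ≤ B) : ∃ K : ℝ, 0 ≤ K ∧
    ∀ (u : ℝ → E → ℂ) (_ : Sol V u) (t : ℝ) (_ : Sch (u t)) (_ : Sch (dt u t)) (n : ℕ),
      ∫ x, ct n x ^ 2 * gr (u t) x ≤ K * ((∫ x, ‖u t x‖ ^ 2) + ∫ x, ‖dt u t x‖ ^ 2) := by
  obtain ⟨K, hK, h⟩ := cacc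
  refine ⟨K * (2 + 2 * B ^ 2), by positivity, fun u hu t s0 s1 n => ?_⟩
  refine (h n (u t) (hu.sm.slice t) s0.sq s0.lap.sq).trans ?_
  have i0 := s0.sq
  have i1 := s1.sq
  have m := integral_mono (μ := volume) s0.lap.sq ((i1.const_mul 2).add (i0.const_mul (2 * B ^ 2)))
    (fun x => lap_L2 hB hu t x)
  simp only [Pi.add_apply] at m
  rw [integral_add (i1.const_mul 2) (i0.const_mul (2 * B ^ 2)), integral_const_mul,
    integral_const_mul] at m
  have j0 : 0 ≤ ∫ x, ‖u t x‖ ^ 2 := integral_nonneg fun x => by positivity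
  have j1 : 0 ≤ ∫ x, ‖dt u t x‖ ^ 2 := integral_nonneg fun x => by positivity
  rw [mul_assoc]
  refine mul_le_mul_of_nonneg_left ?_ hK
  nlinarith [mul_nonneg (sq_nonneg B) j1]

lemma conj_sol {V : E → ℝ} {u : ℝ → E → ℂ} (hu : Sol V u) (t x) :
    dt (fun t x => (starRingEnd ℂ) (u t x)) t x =
      -I * (lap (fun x => (starRingEnd ℂ) (u t x)) x - V x * (starRingEnd ℂ) (u t x)) := by
  rw [dt_conj hu.sm, hu.eq, lap_conj]; simp

lemma Pder {V : E → ℝ} {u v : ℝ → E → ℂ} (hu : Sol V u) (hv : Sol V v) {φ : E → ℂ}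
    (hφ : Continuous φ) (hc : HasCompactSupport φ) (t : ℝ) :
    HasDerivAt (fun t => ∫ x, φ x * ((starRingEnd ℂ) (u t x) * v t x))
      (I * ∫ x, φ x * ((starRingEnd ℂ) (u t x) * lap (v t) x
        - v t x * lap (fun x => (starRingEnd ℂ) (u t x)) x)) t := by
  have h := dInt hφ hc (hu.sm.conj.mul hv.sm) t
  rw [← integral_const_mul]
  have e : ∀ x, φ x * dt (fun t x => (starRingEnd ℂ) (u t x) * v t x) t x =
      I * (φ x * ((starRingEnd ℂ) (u t x) * lap (v t) x
        - v t x * lap (fun x => (starRingEnd ℂ) (u t x)) x)) := by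
    intro x
    rw [dt_mul hu.sm.conj hv.sm, conj_sol hu, hv.eq]
    ring
  simp only [e] at h
  exact h

lemma kappa {V : E → ℝ} {B : ℝ} (hB : ∀ x, |V x| ≤ B) {w : ℝ → E → ℂ} (hw : Hyp V w) {a b N₀ : ℝ}
    (hN : ∀ t ∈ Set.Icc a b, ∫ x, ‖dt w t x‖ ^ 2 ≤ N₀) {h : ℝ} (hh : 0 < h)
    {t₁ t₂ : ℝ} (h1 : t₁ ∈ Set.Icc a (b - h)) (h2 : t₂ ∈ Set.Icc a (b - h)) :
    ∫ x, (starRingEnd ℂ) (dt w t₁ x) * (w (t₁ + h) x - w t₁ x) =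
    ∫ x, (starRingEnd ℂ) (dt w t₂ x) * (w (t₂ + h) x - w t₂ x) := by
  obtain ⟨K, hK, hK'⟩ := gr_bound hB
  obtain ⟨L, hL, hL'⟩ := flux_bound
  have hU := hw.diff h
  set U : ℝ → E → ℂ := fun t x => w (t + h) x - w t x with hUdef
  have hUS : ∀ t, Sch (U t) := fun t => (hw.s0 (t+h)).sub (hw.s0 t)
  have hdU : ∀ t x, dt U t x = dt w (t + h) x - dt w t x := by
    intro t x
    rw [hUdef, dt_sub (hw.sol.sm.shift h) hw.sol.sm, dt_shift hw.sol.sm]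
  have hdUS : ∀ t, Sch (dt U t) := fun t => by
    have : dt U t = fun x => dt w (t + h) x - dt w t x := funext (hdU t)
    rw [this]; exact (hw.s1 (t+h)).sub (hw.s1 t)
  have bU : ∀ t ∈ Set.Icc a (b - h), ∫ x, ‖U t x‖ ^ 2 ≤ 2 * h ^ 2 * N₀ := fun t ht =>
    hw.L2 hN ht.1 hh (by linarith [ht.2])
  have bdU : ∀ t ∈ Set.Icc a (b - h), ∫ x, ‖dt U t x‖ ^ 2 ≤ 4 * N₀ := by
    intro t ht
    have i1 := (hw.s1 (t+h)).sq
    have i2 := (hw.s1 t).sq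
    have m := integral_mono (μ := volume) (hdUS t).sq ((i1.const_mul 2).add (i2.const_mul 2))
      (fun x => by simp only [hdU]; exact norm_sub_sq_le _ _)
    simp only [Pi.add_apply] at m
    rw [integral_add (i1.const_mul 2) (i2.const_mul 2), integral_const_mul,
      integral_const_mul] at m
    have := hN t ⟨ht.1, by linarith [ht.2]⟩
    have := hN (t+h) ⟨by linarith [ht.1], by linarith [ht.2]⟩
    linarith
  set Q : ℝ := N₀ + 2 * h ^ 2 * N₀ + K * (2 * h ^ 2 * N₀ + 4 * N₀) with hQ
  have bP : ∀ n : ℕ, ∀ t ∈ Set.Icc a (b - h),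
     ‖I * ∫ x, c2 n x * ((starRingEnd ℂ) (dt w t x) * lap (U t) x
        - U t x * lap (fun x => (starRingEnd ℂ) (dt w t x)) x)‖ ≤ L / (n + 1) * Q := by
    intro n t ht
    rw [norm_mul, norm_I, one_mul]
    refine (hL' n _ _ (hw.s1 t).conj.sm (hUS t).sm (hw.s1 t).conj.sq (hUS t).sq).trans ?_
    refine mul_le_mul_of_nonneg_left ?_ (by positivity)
    simp only [RCLike.norm_conj]
    have g := hK' U hU t (hUS t) (hdUS t) n
    have m := mul_le_mul_of_nonneg_left (add_le_add (bU t ht) (bdU t ht)) hK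
    have := hN t ⟨ht.1, by linarith [ht.2]⟩
    have := bU t ht
    linarith
  have key : ∀ n : ℕ, ‖(∫ x, c2 n x * ((starRingEnd ℂ) (dt w t₁ x) * U t₁ x))
      - ∫ x, c2 n x * ((starRingEnd ℂ) (dt w t₂ x) * U t₂ x)‖ ≤ L / (n + 1) * Q * ‖t₁ - t₂‖ := by
    intro n
    exact (convex_Icc a (b - h)).norm_image_sub_le_of_norm_hasDerivWithin_le
      (fun t _ => (Pder hw.sol.dt hU (c2_sm n).cont (c2_compact n) t).hasDerivWithinAt)
      (bP n) h2 h1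
  have l1 := ct_lim ((hw.s1 t₁).conj.mul (hUS t₁)).integrable
  have l2 := ct_lim ((hw.s1 t₂).conj.mul (hUS t₂)).integrable
  have l3 : Filter.Tendsto (fun n : ℕ => L / ((n : ℝ) + 1) * Q * ‖t₁ - t₂‖) Filter.atTop (nhds 0) := by
    have := (tendsto_one_div_add_atTop_nhds_zero_nat (𝕜 := ℝ)).const_mul (L * Q * ‖t₁ - t₂‖)
    rw [mul_zero] at this
    refine this.congr fun n => ?_
    ring
  have := le_of_tendsto_of_tendsto' (l1.sub l2).norm l3 key
  exact sub_eq_zero.1 (norm_le_zero_iff.1 this)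

lemma weak {V : E → ℝ} {w : ℝ → E → ℂ} (hw : Hyp V w) {a b N₀ : ℝ}
    (hN : ∀ t ∈ Set.Icc a b, ∫ x, ‖dt w t x‖ ^ 2 ≤ N₀) {t : ℝ} (ht : t ∈ Set.Ico a b) :
    Filter.Tendsto (fun h : ℝ => (h : ℂ)⁻¹ * ∫ x, (starRingEnd ℂ) (dt w t x) * (w (t + h) x - w t x))
      (nhdsWithin 0 (Set.Ioi 0)) (nhds ((∫ x, ‖dt w t x‖ ^ 2 : ℝ) : ℂ)) := by
  have hN0 : 0 ≤ N₀ := (integral_nonneg fun x => by positivity).trans (hN t ⟨ht.1, ht.2.le⟩)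
  have hS := hw.s1 t
  have isq := hS.sq
  rw [Metric.tendsto_nhds]
  intro η hη
  set ε : ℝ := η / (8 * (N₀ + 1)) with hε
  have hε0 : 0 < ε := by positivity
  have hεN : ε * (2 * N₀) ≤ η / 4 := by
    rw [hε, div_mul_eq_mul_div, div_le_div_iff₀ (by positivity) (by norm_num)]
    nlinarith
  -- choose n
  have hR := (ct_lim_real isq)
  set R : ℕ → ℝ := fun n => (∫ x, ‖dt w t x‖ ^ 2) - ∫ x, ct n x ^ 2 * ‖dt w t x‖ ^ 2 with hRd
  have hR' : Filter.Tendsto R Filter.atTop (nhds 0) := by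
    have := hR.const_sub (∫ x, ‖dt w t x‖ ^ 2)
    rw [sub_self] at this
    exact this
  have hR0 : ∀ n, 0 ≤ R n := fun n => sub_nonneg.2
    (ct_le_int n isq (hS.sm.cont.norm.pow 2) fun x => by positivity)
  obtain ⟨n, hn1, hn2⟩ := ((hR'.eventually_lt_const (show 0 < η / 4 by positivity)).and
    (hR'.eventually_lt_const (show 0 < η / 4 * (4 * ε) by positivity))).exists
  -- derivative of truncated
  have hφ : Continuous (fun x => c2 n x * (starRingEnd ℂ) (dt w t x)) :=
    (c2_sm n).cont.mul hS.conj.sm.cont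
  have hφc : HasCompactSupport (fun x => c2 n x * (starRingEnd ℂ) (dt w t x)) :=
    (c2_compact n).mul_right
  have hd := dInt hφ hφc hw.sol.sm t
  have hsl := hd.tendsto_slope_zero.mono_left
    (nhdsWithin_mono 0 (fun x (hx : 0 < x) => hx.ne') : nhdsWithin (0:ℝ) (Set.Ioi 0) ≤ _)
  have eD : ∫ x, c2 n x * (starRingEnd ℂ) (dt w t x) * dt w t x
      = ((∫ x, ct n x ^ 2 * ‖dt w t x‖ ^ 2 : ℝ) : ℂ) := by
    rw [← integral_complex_ofReal]
    congr 1; ext x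
    rw [mul_assoc, conj_mul', c2, cc]; push_cast; ring
  rw [eD] at hsl
  have hev := (Metric.tendsto_nhds.1 hsl) (η / 4) (by positivity)
  have hev2 : ∀ᶠ h : ℝ in nhdsWithin 0 (Set.Ioi 0), h ∈ Set.Ioo 0 (b - t) :=
    Ioo_mem_nhdsGT (by linarith [ht.2])
  filter_upwards [hev, hev2] with h hd1 hh
  have hS0 := hw.s0 (t + h)
  have hS1 := hw.s0 t
  have iU : Integrable (fun x => ‖w (t + h) x - w t x‖ ^ 2) := (hS0.sub hS1).sq
  have bU := hw.L2 hN ht.1 hh.1 (by linarith [hh.2])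
  have hc : (h : ℂ) ≠ 0 := by exact_mod_cast hh.1.ne'
  -- identify truncated difference quotient
  have e1 : (∫ x, c2 n x * (starRingEnd ℂ) (dt w t x) * w (t + h) x)
      - (∫ x, c2 n x * (starRingEnd ℂ) (dt w t x) * w t x)
      = ∫ x, c2 n x * ((starRingEnd ℂ) (dt w t x) * (w (t + h) x - w t x)) := by
    rw [← integral_sub (Sm.cmpInt hφ hφc hS0.sm.cont) (Sm.cmpInt hφ hφc hS1.sm.cont)]
    congr 1; ext x; ring
  rw [e1, Complex.real_smul, ofReal_inv] at hd1
  set κ := ∫ x, (starRingEnd ℂ) (dt w t x) * (w (t + h) x - w t x) with hκ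
  set κn := ∫ x, c2 n x * ((starRingEnd ℂ) (dt w t x) * (w (t + h) x - w t x)) with hκn
  have hmain : ‖(h : ℂ)⁻¹ * κ - (h : ℂ)⁻¹ * κn‖ ≤ 1 / (4 * ε) * R n + ε * (2 * N₀) := by
    have e2 : (h : ℂ)⁻¹ * κ - (h : ℂ)⁻¹ * κn = ∫ x, (h : ℂ)⁻¹ * ((1 - c2 n x) *
        ((starRingEnd ℂ) (dt w t x) * (w (t + h) x - w t x))) := by
      have j1 := (hS.conj.mul (hS0.sub hS1)).integrable
      have j2 : Integrable (fun x => c2 n x * ((starRingEnd ℂ) (dt w t x) * (w (t + h) x - w t x))) :=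
        Sm.cmpInt (c2_sm n).cont (c2_compact n) (hS.conj.mul (hS0.sub hS1)).sm.cont
      rw [← mul_sub, hκ, hκn, ← integral_sub j1 j2, ← integral_const_mul]
      congr 1; ext x; ring
    have i3 : Integrable (fun x => ct n x ^ 2 * ‖dt w t x‖ ^ 2) := ct_int n (hS.sm.cont.norm.pow 2)
    have i4 : Integrable (fun x => ‖dt w t x‖ ^ 2 - ct n x ^ 2 * ‖dt w t x‖ ^ 2) := isq.sub i3
    have e3 : 1 / (4 * ε) * R n + ε * ((1 / h ^ 2) * ∫ x, ‖w (t + h) x - w t x‖ ^ 2)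
       = ∫ x, (1 / (4 * ε) * (‖dt w t x‖ ^ 2 - ct n x ^ 2 * ‖dt w t x‖ ^ 2) +
          ε * ((1 / h ^ 2) * ‖w (t + h) x - w t x‖ ^ 2)) := by
      rw [integral_add (i4.const_mul _) ((iU.const_mul _).const_mul _), integral_const_mul,
        integral_const_mul, integral_const_mul, integral_sub isq i3]
    have hle : 1 / (4 * ε) * R n + ε * ((1 / h ^ 2) * ∫ x, ‖w (t + h) x - w t x‖ ^ 2)
       ≤ 1 / (4 * ε) * R n + ε * (2 * N₀) := by
      have : (1 / h ^ 2) * ∫ x, ‖w (t + h) x - w t x‖ ^ 2 ≤ 2 * N₀ := by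
        have hp : 0 < h ^ 2 := by have := hh.1; positivity
        rw [one_div, inv_mul_le_iff₀ hp]; linarith
      have := mul_le_mul_of_nonneg_left this hε0.le
      linarith
    refine le_trans ?_ hle
    rw [e2, e3]
    refine norm_integral_le_of_norm_le ((i4.const_mul _).add ((iU.const_mul _).const_mul _))
      (Filter.Eventually.of_forall fun x => ?_)
    have a0 := ct_nonneg n x
    have a1 := ct_le_one n x
    have e5 : ‖1 - c2 n x‖ = 1 - ct n x ^ 2 := by
      have : 1 - c2 n x = ((1 - ct n x ^ 2 : ℝ) : ℂ) := by rw [c2, cc]; push_cast; ring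
      rw [this, Complex.norm_real, Real.norm_of_nonneg]
      nlinarith
    simp only [norm_mul, norm_inv, Complex.norm_real, RCLike.norm_conj, e5, Real.norm_of_nonneg hh.1.le]
    set p := ‖dt w t x‖
    set q := ‖w (t + h) x - w t x‖
    have hq : 0 ≤ q := norm_nonneg _
    have hp : 0 ≤ p := norm_nonneg _
    have c01 : 0 ≤ 1 - ct n x ^ 2 := by nlinarith
    have hh0 := hh.1
    have am : p * (h⁻¹ * q) ≤ 1 / (4 * ε) * p ^ 2 + ε * ((1 / h ^ 2) * q ^ 2) := by
      have : 1 / (4 * ε) * p ^ 2 + ε * ((1 / h ^ 2) * q ^ 2) - p * (h⁻¹ * q)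
        = 1 / (4 * ε) * (p - 2 * ε * (h⁻¹ * q)) ^ 2 := by field_simp; ring
      have h3 : 0 ≤ 1 / (4 * ε) * (p - 2 * ε * (h⁻¹ * q)) ^ 2 := by positivity
      linarith
    have m1 := mul_le_mul_of_nonneg_left am c01
    have m2 : 0 ≤ ct n x ^ 2 * (ε * ((1 / h ^ 2) * q ^ 2)) := by positivity
    nlinarith
  have hRn : 1 / (4 * ε) * R n ≤ η / 4 := by
    rw [one_div, inv_mul_le_iff₀ (by positivity)]; linarith
  have d2 : dist (((∫ x, ct n x ^ 2 * ‖dt w t x‖ ^ 2 : ℝ)) : ℂ) ((∫ x, ‖dt w t x‖ ^ 2 : ℝ) : ℂ) < η / 4 := by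
    rw [dist_comm, dist_eq_norm, ← ofReal_sub, Complex.norm_real, Real.norm_of_nonneg (hR0 n)]
    exact hn1
  rw [← dist_eq_norm] at hmain
  have tri := dist_triangle4 ((h : ℂ)⁻¹ * κ) ((h : ℂ)⁻¹ * κn)
    (((∫ x, ct n x ^ 2 * ‖dt w t x‖ ^ 2 : ℝ)) : ℂ) ((∫ x, ‖dt w t x‖ ^ 2 : ℝ) : ℂ)
  linarith

lemma LP0 {V : E → ℝ} {B : ℝ} (hB : ∀ x, |V x| ≤ B) {w : ℝ → E → ℂ} (hw : Hyp V w) {a b N₀ : ℝ}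
    (hN : ∀ t ∈ Set.Icc a b, ∫ x, ‖dt w t x‖ ^ 2 ≤ N₀)
    {t₁ t₂ : ℝ} (h1 : t₁ ∈ Set.Ico a b) (h2 : t₂ ∈ Set.Ico a b) :
    ∫ x, ‖dt w t₁ x‖ ^ 2 = ∫ x, ‖dt w t₂ x‖ ^ 2 := by
  have l1 := weak hw hN h1
  have l2 := weak hw hN h2
  have hev : ∀ᶠ h : ℝ in nhdsWithin 0 (Set.Ioi 0), h ∈ Set.Ioo 0 (min (b - t₁) (b - t₂)) :=
    Ioo_mem_nhdsGT (lt_min (by linarith [h1.2]) (by linarith [h2.2]))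
  have l3 := l1.congr' (f₂ := fun h : ℝ => (h : ℂ)⁻¹ *
      ∫ x, (starRingEnd ℂ) (dt w t₂ x) * (w (t₂ + h) x - w t₂ x)) (by
    filter_upwards [hev] with h hh
    have := lt_min_iff.1 hh.2
    rw [kappa hB hw hN hh.1 ⟨h1.1, by linarith⟩ ⟨h2.1, by linarith⟩])
  exact ofReal_injective (tendsto_nhds_unique l3 l2)

lemma Hyp.rev {V : E → ℝ} {w : ℝ → E → ℂ} (hw : Hyp V w) :
    Hyp V (fun t x => (starRingEnd ℂ) (w (-t) x)) ∧
    ∀ t x, ‖dt (fun t x => (starRingEnd ℂ) (w (-t) x)) t x‖ = ‖dt w (-t) x‖ := by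
  have hd : ∀ t x, dt (fun t x => (starRingEnd ℂ) (w (-t) x)) t x
      = (-1) * (starRingEnd ℂ) (dt w (-t) x) := by
    intro t x
    rw [hw.sol.rev.eq, hw.sol.eq, lap_conj]; simp
  refine ⟨⟨hw.sol.rev, fun t => (hw.s0 _).conj, fun t => ?_⟩, fun t x => ?_⟩
  · rw [funext (hd t)]
    exact ((hw.s1 (-t)).conj).cmul (-1)
  · rw [hd]; simp

lemma LP {V : E → ℝ} {B : ℝ} (hB : ∀ x, |V x| ≤ B) {w : ℝ → E → ℂ} (hw : Hyp V w) {a b N₀ : ℝ}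
    (hN : ∀ t ∈ Set.Icc a b, ∫ x, ‖dt w t x‖ ^ 2 ≤ N₀)
    {t₁ t₂ : ℝ} (h1 : t₁ ∈ Set.Icc a b) (h2 : t₂ ∈ Set.Icc a b) :
    ∫ x, ‖dt w t₁ x‖ ^ 2 = ∫ x, ‖dt w t₂ x‖ ^ 2 := by
  rcases (h1.1.trans h1.2).eq_or_lt with hab | hab
  · have : t₁ = t₂ := le_antisymm (by linarith [h1.2, h2.1]) (by linarith [h1.1, h2.2])
    rw [this]
  have hN' : ∀ t ∈ Set.Icc (-b) (-a),
      ∫ x, ‖dt (fun t x => (starRingEnd ℂ) (w (-t) x)) t x‖ ^ 2 ≤ N₀ := by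
    intro t ht
    simp only [hw.rev.2]
    exact hN (-t) ⟨by linarith [ht.2], by linarith [ht.1]⟩
  have main : ∀ t ∈ Set.Icc a b, ∫ x, ‖dt w t x‖ ^ 2 = ∫ x, ‖dt w ((a + b) / 2) x‖ ^ 2 := by
    intro t ht
    rcases ht.2.eq_or_lt with hb | hb
    · have := LP0 hB hw.rev.1 hN' (t₁ := -t) (t₂ := -((a + b) / 2))
        ⟨by linarith, by linarith⟩ ⟨by linarith, by linarith⟩
      simpa only [hw.rev.2, neg_neg] using this
    · exact LP0 hB hw hN ⟨ht.1, hb⟩ ⟨by linarith, by linarith⟩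
  rw [main t₁ h1, main t₂ h2]

end DilId

namespace DilId
open SchwartzMap Complex

lemma baire_const {N : ℝ → ℝ} (hcl : ∀ c, IsClosed {t | N t ≤ c})
    (hP : ∀ a b C, (∀ t ∈ Set.Icc a b, N t ≤ C) →
      ∀ t₁ ∈ Set.Icc a b, ∀ t₂ ∈ Set.Icc a b, N t₁ = N t₂) (s t : ℝ) : N s = N t := by
  set U : Set ℝ := {t | ∃ C, ∀ᶠ s in nhds t, N s ≤ C} with hU
  have hUo : IsOpen U := by
    rw [isOpen_iff_eventually]
    rintro x ⟨C, hC⟩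
    filter_upwards [eventually_eventually_nhds.2 hC] with y hy using ⟨C, hy⟩
  have clA : ∀ a b, Set.Icc a b ⊆ U → ∀ t₁ ∈ Set.Icc a b, ∀ t₂ ∈ Set.Icc a b, N t₁ = N t₂ := by
    intro a b hab
    have : ∃ C, ∀ t ∈ Set.Icc a b, N t ≤ C := by
      refine (isCompact_Icc (a := a) (b := b)).induction_on
        (p := fun s => ∃ C, ∀ t ∈ s, N t ≤ C) ⟨0, by simp⟩ ?_ ?_ ?_
      · rintro s t hst ⟨C, hC⟩; exact ⟨C, fun x hx => hC x (hst hx)⟩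
      · rintro s t ⟨C, hC⟩ ⟨D, hD⟩
        refine ⟨max C D, fun x hx => ?_⟩
        rcases hx with hx | hx
        · exact (hC x hx).trans (le_max_left _ _)
        · exact (hD x hx).trans (le_max_right _ _)
      · intro x hx
        obtain ⟨C, hC⟩ := hab hx
        exact ⟨_, mem_nhdsWithin_of_mem_nhds hC, C, fun t ht => ht⟩
    obtain ⟨C, hC⟩ := this
    exact hP a b C hC
  have clB : ∀ a t, a < t → Set.Ioc a t ⊆ U → N t = N a := by
    intro a t hat h
    refine hP a t (max (N a) (N t)) (fun s hs => ?_) t ⟨hat.le, le_refl _⟩ a ⟨le_refl _, hat.le⟩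
    rcases hs.1.eq_or_lt with h1 | h1
    · rw [← h1]; exact le_max_left _ _
    · rw [clA s t (fun r hr => h ⟨h1.trans_le hr.1, hr.2⟩) s ⟨le_refl _, hs.2⟩ t ⟨hs.2, le_refl _⟩]
      exact le_max_right _ _
  have clB' : ∀ t b, t < b → Set.Ico t b ⊆ U → N t = N b := by
    intro t b htb h
    refine hP t b (max (N b) (N t)) (fun s hs => ?_) t ⟨le_refl _, htb.le⟩ b ⟨htb.le, le_refl _⟩
    rcases hs.2.eq_or_lt with h1 | h1
    · rw [h1]; exact le_max_left _ _
    · rw [clA t s (fun r hr => h ⟨hr.1, hr.2.trans_lt h1⟩) s ⟨hs.1, le_refl _⟩ t ⟨le_refl _, hs.1⟩]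
      exact le_max_right _ _
  have hF : Uᶜ = ∅ := by
    by_contra hne
    have hne' : (Uᶜ).Nonempty := Set.nonempty_iff_ne_empty.2 hne
    have hFc : IsClosed Uᶜ := hUo.isClosed_compl
    haveI : Nonempty (Uᶜ : Set ℝ) := hne'.to_subtype
    haveI : CompleteSpace (Uᶜ : Set ℝ) := hFc.completeSpace_coe
    obtain ⟨n, ⟨t0, ht0⟩, hint⟩ := nonempty_interior_of_iUnion_of_closed
      (f := fun n : ℕ => {t : (Uᶜ : Set ℝ) | N t ≤ n})
      (fun n => (hcl n).preimage continuous_subtype_val) (by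
        ext t; simp only [Set.mem_iUnion, Set.mem_setOf_eq, Set.mem_univ, iff_true]
        exact exists_nat_ge _)
    rw [mem_interior_iff_mem_nhds, Metric.mem_nhds_iff] at hint
    obtain ⟨δ, hδ, hball⟩ := hint
    have hb : ∀ t ∈ Uᶜ, |t - t0| < δ → N t ≤ n := fun t ht htd =>
      @hball ⟨t, ht⟩ (by simpa [Metric.mem_ball, Subtype.dist_eq, Real.dist_eq] using htd)
    refine ht0 ⟨n, ?_⟩
    filter_upwards [Metric.ball_mem_nhds t0 hδ] with t ht
    rw [Metric.mem_ball, Real.dist_eq] at ht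
    by_cases htU : t ∈ Uᶜ
    · exact hb t htU ht
    have htU' : t ∈ U := not_not.1 htU
    rcases lt_trichotomy t0 t with h | h | h
    · have hc : IsCompact (Uᶜ ∩ Set.Icc t0 t) := isCompact_Icc.inter_left hFc
      have hm := hc.sSup_mem ⟨t0, ht0, le_refl _, h.le⟩
      set a := sSup (Uᶜ ∩ Set.Icc t0 t) with ha
      have hat : a < t := lt_of_le_of_ne hm.2.2 (fun e => htU (e ▸ hm.1))
      have : Set.Ioc a t ⊆ U := by
        intro r hr
        by_contra hrU
        have := le_csSup hc.bddAbove (a := r) ⟨hrU, hm.2.1.trans hr.1.le, hr.2⟩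
        exact absurd hr.1 (not_lt.2 this)
      rw [clB a t hat this]
      refine hb a hm.1 ?_
      rw [abs_of_nonneg (by linarith [hm.2.1])]
      rw [abs_of_nonneg (by linarith)] at ht
      linarith
    · exact absurd (h ▸ ht0) htU
    · have hc : IsCompact (Uᶜ ∩ Set.Icc t t0) := isCompact_Icc.inter_left hFc
      have hm := hc.sInf_mem ⟨t0, ht0, h.le, le_refl _⟩
      set a := sInf (Uᶜ ∩ Set.Icc t t0) with ha
      have hat : t < a := lt_of_le_of_ne hm.2.1 (fun e => htU (e ▸ hm.1))
      have : Set.Ico t a ⊆ U := by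
        intro r hr
        by_contra hrU
        have := csInf_le hc.bddBelow (a := r) ⟨hrU, hr.1, hr.2.le.trans hm.2.2⟩
        exact absurd hr.2 (not_lt.2 this)
      rw [clB' t a hat this]
      refine hb a hm.1 ?_
      rw [abs_of_nonpos (by linarith [hm.2.2])]
      rw [abs_of_nonpos (by linarith)] at ht
      linarith
  have hUu : U = Set.univ := by rw [← compl_compl U, hF, Set.compl_empty]
  rcases le_total s t with h | h
  · exact clA s t (by simp [hUu]) s ⟨le_refl _, h⟩ t ⟨h, le_refl _⟩
  · exact clA t s (by simp [hUu]) s ⟨h, le_refl _⟩ t ⟨le_refl _, h⟩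

lemma N_closed {u : ℝ → E → ℂ} (hu : Sm2 u) (hs : ∀ t, Sch (u t)) (c : ℝ) :
    IsClosed {t | ∫ x, ‖u t x‖ ^ 2 ≤ c} := by
  have : {t | ∫ x, ‖u t x‖ ^ 2 ≤ c} = ⋂ n : ℕ, {t | ∫ x, ct n x ^ 2 * ‖u t x‖ ^ 2 ≤ c} := by
    ext t
    simp only [Set.mem_setOf_eq, Set.mem_iInter]
    constructor
    · intro h n
      exact (ct_le_int n (hs t).sq ((hs t).sm.cont.norm.pow 2) fun x => by positivity).trans h
    · intro h
      exact le_of_tendsto' (ct_lim_real (hs t).sq) h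
  rw [this]
  refine isClosed_iInter fun n => isClosed_le ?_ continuous_const
  exact continuous_iff_continuousAt.2 fun t =>
    (yder (ct2_cont n) (ct2_compact n) hu t).continuousAt

lemma N1_const {V : E → ℝ} {B : ℝ} (hB : ∀ x, |V x| ≤ B) {w : ℝ → E → ℂ} (hw : Hyp V w) (s t : ℝ) :
    ∫ x, ‖dt w s x‖ ^ 2 = ∫ x, ‖dt w t x‖ ^ 2 :=
  baire_const (N := fun t => ∫ x, ‖dt w t x‖ ^ 2) (N_closed hw.sol.sm.dt hw.s1)
    (fun _ _ _ h _ h1 _ h2 => LP hB hw h h1 h2) s t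

/-- local bound for the mass of `w` itself -/
lemma N0_bdd {V : E → ℝ} {B : ℝ} (hB : ∀ x, |V x| ≤ B) {w : ℝ → E → ℂ} (hw : Hyp V w) (a b : ℝ) :
    ∃ C, 0 ≤ C ∧ ∀ t ∈ Set.Icc a b, ∫ x, ‖w t x‖ ^ 2 ≤ C := by
  set N := ∫ x, ‖dt w 0 x‖ ^ 2 with hNd
  have hN0 : 0 ≤ N := integral_nonneg fun x => by positivity
  have hA0 : 0 ≤ ∫ x, ‖w a x‖ ^ 2 := integral_nonneg fun x => by positivity
  refine ⟨4 * (b - a) ^ 2 * N + 2 * ∫ x, ‖w a x‖ ^ 2, by positivity, fun t ht => ?_⟩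
  rcases ht.1.eq_or_lt with h | h
  · rw [← h]
    have : 0 ≤ 4 * (b - a) ^ 2 * N := by positivity
    linarith
  have hL := hw.L2 (a := a) (b := b) (N₀ := N) (fun t _ => (N1_const hB hw t 0).le) (t := a)
    (h := t - a) (le_refl _) (by linarith) (by linarith [ht.2])
  rw [add_sub_cancel] at hL
  have i1 := ((hw.s0 t).sub (hw.s0 a)).sq
  have i2 := (hw.s0 a).sq
  have m := integral_mono (μ := volume) (hw.s0 t).sq ((i1.const_mul 2).add (i2.const_mul 2))
    (fun x => by
      have := norm_sub_sq_le (w t x - w a x) (-(w a x))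
      simpa using this)
  simp only [Pi.add_apply] at m
  rw [integral_add (i1.const_mul 2) (i2.const_mul 2), integral_const_mul, integral_const_mul] at m
  have : (t - a) ^ 2 ≤ (b - a) ^ 2 := by nlinarith [ht.2]
  nlinarith [mul_le_mul_of_nonneg_right this hN0]

end DilId

namespace DilId
open SchwartzMap Complex

noncomputable def nq (x : E) : ℂ := ((‖x‖ ^ 2 : ℝ) : ℂ)
lemma nq_temp : nq.HasTemperateGrowth := temp_nsq
lemma nq_sm : Sm nq := temp_nsq.1
lemma dd_nq (j x) : dd j nq x = 2 * ((x j : ℝ) : ℂ) := by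
  have hd : ∀ x : E, HasFDerivAt (fun x : E => ‖x‖ ^ 2) (2 • innerSL ℝ x) x :=
    fun x => (hasStrictFDerivAt_norm_sq x).hasFDerivAt
  have := dd_ofReal (f := fun x : E => ‖x‖ ^ 2) (fun x => (hd x).differentiableAt) j x
  rw [(hd x).fderiv] at this
  unfold nq
  rw [this]
  simp [ee, EuclideanSpace.inner_single_right]

lemma Sch.gr_int {f : E → ℂ} (h : Sch f) : Integrable (gr f) :=
  integrable_finsetSum _ fun j _ => (h.dd j).sq

lemma Sch.nq_int {f g : E → ℂ} (h : Sch f) (hg : Sch g) :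
    Integrable (fun x => nq x * ((starRingEnd ℂ) (f x) * g x)) :=
  (Sch.tmul nq_temp (h.conj.mul hg)).integrable

lemma Sch.wt_int {f : E → ℂ} (h : Sch f) : Integrable (fun x => ‖x‖ ^ 2 * ‖f x‖ ^ 2) := by
  refine (h.nq_int h).norm.congr (Filter.Eventually.of_forall fun x => ?_)
  simp only [norm_mul, RCLike.norm_conj, nq, Complex.norm_real]
  rw [Real.norm_of_nonneg (by positivity)]; ring

lemma wt_cont {f : E → ℂ} (h : Sm f) : Continuous (fun x => ‖x‖ ^ 2 * ‖f x‖ ^ 2) :=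
  (continuous_norm.pow 2).mul (h.cont.norm.pow 2)

lemma wt_flux : ∃ A : ℝ, 0 < A ∧ ∀ (n : ℕ) (f : E → ℂ), Sch f →
    ‖∫ x, (c2 n x * nq x) * ((starRingEnd ℂ) (f x) * lap f x
        - f x * lap (fun x => (starRingEnd ℂ) (f x)) x)‖
     ≤ A * ((∫ x, ct n x ^ 2 * (‖x‖ ^ 2 * ‖f x‖ ^ 2)) + ∫ x, gr f x) := by
  obtain ⟨C, hC1, hC⟩ := cut_bounds
  refine ⟨3 * (2 * C + 2), by positivity, fun n f hf => ?_⟩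
  rw [flux1 ((c2_sm n).mul nq_sm) (c2_compact n).mul_right hf.conj.sm hf.sm, norm_neg]
  have i1 := ct_int n (wt_cont hf.sm)
  rw [← integral_add i1 hf.gr_int, ← integral_const_mul]
  refine norm_integral_le_of_norm_le ((i1.add hf.gr_int).const_mul _)
    (Filter.Eventually.of_forall fun x => ?_)
  have a0 := ct_nonneg n x
  have a1 := ct_le_one n x
  have two : ‖(2:ℂ)‖ = 2 := by simp
  have b : ∀ j, ‖dd j (fun x => c2 n x * nq x) x * ((starRingEnd ℂ) (f x) * dd j f x
      - f x * dd j (fun x => (starRingEnd ℂ) (f x)) x)‖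
      ≤ (2 * C + 2) * (ct n x ^ 2 * (‖x‖ ^ 2 * ‖f x‖ ^ 2) + ‖dd j f x‖ ^ 2) := by
    intro j
    obtain ⟨-, k2, -⟩ := hC n j x
    have d1 : ‖dd j (fun x => c2 n x * nq x) x‖ ≤ (2 * C + 2) * (ct n x * ‖x‖) := by
      rw [dd_mul (c2_sm n) nq_sm, dd_c2, dd_nq]
      refine (norm_add_le _ _).trans ?_
      simp only [norm_mul, norm_cc, two, c2, nq, Complex.norm_real]
      rw [Real.norm_of_nonneg (by positivity : 0 ≤ ‖x‖ ^ 2)]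
      have hx : ‖x j‖ ≤ ‖x‖ := PiLp.norm_apply_le x j
      have p : 0 ≤ ct n x * ‖x‖ := by positivity
      have m1 := mul_le_mul_of_nonneg_left k2 p
      have m2 : ct n x * ct n x * ‖x j‖ ≤ ct n x * ‖x‖ := by
        calc ct n x * ct n x * ‖x j‖ ≤ ct n x * 1 * ‖x‖ := by gcongr
          _ = _ := by ring
      nlinarith
    have d2 : ‖(starRingEnd ℂ) (f x) * dd j f x - f x * dd j (fun x => (starRingEnd ℂ) (f x)) x‖
        ≤ 2 * (‖f x‖ * ‖dd j f x‖) := by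
      rw [dd_conj]
      refine (norm_sub_le _ _).trans (le_of_eq ?_)
      simp only [norm_mul, RCLike.norm_conj]; ring
    rw [norm_mul]
    have m := mul_le_mul d1 d2 (norm_nonneg _) (by positivity)
    have s := mul_nonneg (show 0 ≤ 2 * C + 2 by positivity) (sq_nonneg (ct n x * ‖x‖ * ‖f x‖ - ‖dd j f x‖))
    nlinarith
  refine (norm_sum_le _ _).trans ((Finset.sum_le_sum fun j _ => b j).trans ?_)
  simp only [gr, Fin.sum_univ_three]
  have z : ∀ j, 0 ≤ (2 * C + 2) * ‖dd j f x‖ ^ 2 := fun j => by positivity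
  linarith [z 0, z 1, z 2]

lemma wt_bdd {V : E → ℝ} {B : ℝ} (hB : ∀ x, |V x| ≤ B) {w : ℝ → E → ℂ} (hw : Hyp V w) (a b : ℝ) :
    ∃ C, ∀ (n : ℕ), ∀ t ∈ Set.Icc a b, ∫ x, ct n x ^ 2 * (‖x‖ ^ 2 * ‖w t x‖ ^ 2) ≤ C := by
  obtain ⟨C0, hC0, hC0'⟩ := N0_bdd hB hw a b
  obtain ⟨K, hK, hK'⟩ := gr_bound hB
  obtain ⟨A, hA, hA'⟩ := wt_flux
  set N := ∫ x, ‖dt w 0 x‖ ^ 2 with hNd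
  have hN0 : 0 ≤ N := integral_nonneg fun x => by positivity
  set D := K * (C0 + N) with hD
  have hD0 : 0 ≤ D := by positivity
  have hgr : ∀ t ∈ Set.Icc a b, ∫ x, gr (w t) x ≤ D := by
    intro t ht
    refine le_of_tendsto' (ct_lim_real (hw.s0 t).gr_int) fun n => ?_
    refine (hK' w hw.sol t (hw.s0 t) (hw.s1 t) n).trans ?_
    refine mul_le_mul_of_nonneg_left (add_le_add (hC0' t ht) (N1_const hB hw t 0).le) hK
  set Y := ∫ x, ‖x‖ ^ 2 * ‖w a x‖ ^ 2 with hY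
  have hY0 : 0 ≤ Y := integral_nonneg fun x => by positivity
  refine ⟨(Y + D) * Real.exp (A * (b - a)), fun n t ht => ?_⟩
  have hφ : Continuous (fun x => c2 n x * nq x) := ((c2_sm n).mul nq_sm).cont
  have hc : HasCompactSupport (fun x => c2 n x * nq x) := (c2_compact n).mul_right
  have hd := fun t => Pder hw.sol hw.sol hφ hc t
  have hd' := fun t => (reCLM.hasFDerivAt (x := ∫ x, (c2 n x * nq x) *
    ((starRingEnd ℂ) (w t x) * w t x))).comp_hasDerivAt t (hd t)
  have ey : ∀ t, ∫ x, (c2 n x * nq x) * ((starRingEnd ℂ) (w t x) * w t x)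
      = ((∫ x, ct n x ^ 2 * (‖x‖ ^ 2 * ‖w t x‖ ^ 2) : ℝ) : ℂ) := by
    intro t
    rw [← integral_complex_ofReal]
    refine integral_congr_ae (Filter.Eventually.of_forall fun x => ?_)
    simp only [conj_mul', c2, cc, nq]; push_cast; ring
  have ey' : ∀ t, (∫ x, ct n x ^ 2 * (‖x‖ ^ 2 * ‖w t x‖ ^ 2)) =
    reCLM (∫ x, (c2 n x * nq x) * ((starRingEnd ℂ) (w t x) * w t x)) := by
    intro t; rw [ey, reCLM_apply, ofReal_re]
  have key := gron (y := fun t => ∫ x, ct n x ^ 2 * (‖x‖ ^ 2 * ‖w t x‖ ^ 2))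
    (a := a) (b := b) (A := A) (B := A * D) hA
    (fun t _ => (hd' t).congr_of_eventuallyEq (Filter.Eventually.of_forall ey'))
    (fun t ht => by
      rw [reCLM_apply]
      refine (re_le_norm _).trans ?_
      rw [norm_mul, norm_I, one_mul]
      refine (hA' n (w t) (hw.s0 t)).trans ?_
      have := mul_le_mul_of_nonneg_left (hgr t ht) hA.le
      linarith) t ht
  have e1 : A * D / A = D := by field_simp
  rw [e1] at key
  have hya : ∫ x, ct n x ^ 2 * (‖x‖ ^ 2 * ‖w a x‖ ^ 2) ≤ Y :=
    ct_le_int n (hw.s0 a).wt_int (wt_cont (hw.s0 a).sm) fun x => by positivity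
  have he : Real.exp (A * (t - a)) ≤ Real.exp (A * (b - a)) :=
    Real.exp_le_exp.2 (mul_le_mul_of_nonneg_left (by linarith [ht.2]) hA.le)
  have h3 : ((∫ x, ct n x ^ 2 * (‖x‖ ^ 2 * ‖w a x‖ ^ 2)) + D) * Real.exp (A * (t - a))
     ≤ (Y + D) * Real.exp (A * (b - a)) := by
    exact mul_le_mul (by linarith) he (Real.exp_pos _).le (by positivity)
  linarith

/-- passing to the limit in a derivative -/
lemma lim_deriv {f f1 f2 : ℕ → ℝ → ℂ} {g : ℝ → ℂ} {g1 : ℂ} {t C : ℝ}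
    (h1 : ∀ n s, HasDerivAt (f n) (f1 n s) s) (h2 : ∀ n s, HasDerivAt (f1 n) (f2 n s) s)
    (hC : ∀ n, ∀ s ∈ Set.Icc (t - 1) (t + 1), ‖f2 n s‖ ≤ C)
    (l0 : ∀ s, Filter.Tendsto (fun n => f n s) Filter.atTop (nhds (g s)))
    (l1 : Filter.Tendsto (fun n => f1 n t) Filter.atTop (nhds g1)) :
    HasDerivAt g g1 t := by
  have ht : t ∈ Set.Icc (t - 1) (t + 1) := ⟨by linarith, by linarith⟩
  have hC0 : 0 ≤ C := (norm_nonneg _).trans (hC 0 t ht)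
  have b1 : ∀ n, ∀ s ∈ Set.Icc (t - 1) (t + 1), ‖f1 n s - f1 n t‖ ≤ C * ‖s - t‖ := fun n s hs =>
    (convex_Icc (t - 1) (t + 1)).norm_image_sub_le_of_norm_hasDerivWithin_le
      (fun r _ => (h2 n r).hasDerivWithinAt) (hC n) ht hs
  have b2 : ∀ n, ∀ s ∈ Set.Icc (t - 1) (t + 1),
      ‖f n s - f n t - (s - t) • f1 n t‖ ≤ C * ‖s - t‖ * ‖s - t‖ := by
    intro n s hs
    have hsub : Set.uIcc t s ⊆ Set.Icc (t - 1) (t + 1) := Set.uIcc_subset_Icc ht hs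
    have hd : ∀ r, HasDerivAt (fun r => f n r - (r - t) • f1 n t) (f1 n r - f1 n t) r := by
      intro r
      have := ((hasDerivAt_id r).sub_const t).smul_const (f1 n t)
      rw [one_smul] at this
      exact (h1 n r).sub this
    have := (convex_uIcc t s).norm_image_sub_le_of_norm_hasDerivWithin_le (C := C * ‖s - t‖)
      (fun r _ => (hd r).hasDerivWithinAt) (fun r hr => (b1 n r (hsub hr)).trans
        (mul_le_mul_of_nonneg_left (by
          have := Set.abs_sub_left_of_mem_uIcc hr
          simpa [Real.norm_eq_abs] using this) hC0)) Set.left_mem_uIcc Set.right_mem_uIcc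
    have e : f n s - f n t - (s - t) • f1 n t
        = f n s - (s - t) • f1 n t - (f n t - (t - t) • f1 n t) := by
      rw [sub_self t, zero_smul]; ring
    rw [e]; exact this
  have b3 : ∀ s ∈ Set.Icc (t - 1) (t + 1), ‖g s - g t - (s - t) • g1‖ ≤ C * ‖s - t‖ * ‖s - t‖ := by
    intro s hs
    exact le_of_tendsto' (((l0 s).sub (l0 t)).sub (l1.const_smul (s - t))).norm fun n => b2 n s hs
  rw [hasDerivAt_iff_isLittleO]
  have hO : (fun s => g s - g t - (s - t) • g1) =O[nhds t] fun s => (s - t) ^ 2 := by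
    refine Asymptotics.IsBigO.of_bound C ?_
    filter_upwards [Icc_mem_nhds (show t - 1 < t by linarith) (show t < t + 1 by linarith)] with s hs
    refine (b3 s hs).trans (le_of_eq ?_)
    rw [norm_pow]; ring
  refine hO.trans_isLittleO ?_
  have h0 : Filter.Tendsto (fun s : ℝ => s - t) (nhds t) (nhds 0) := by
    have h : Continuous (fun s : ℝ => s - t) := by fun_prop
    have := h.tendsto t
    rwa [sub_self] at this
  exact (Asymptotics.isLittleO_pow_id one_lt_two).comp_tendsto h0

end DilId

namespace DilId
open SchwartzMap Complex

noncomputable def Bn (u v : ℝ → E → ℂ) (n : ℕ) (s : ℝ) : ℂ :=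
  ∫ x, (c2 n x * nq x) * ((starRingEnd ℂ) (u s x) * v s x)

noncomputable def BB (u v : ℝ → E → ℂ) (s : ℝ) : ℂ :=
  ∫ x, nq x * ((starRingEnd ℂ) (u s x) * v s x)

lemma Bn_der {u v : ℝ → E → ℂ} (hu : Sm2 u) (hv : Sm2 v) (n : ℕ) (s : ℝ) :
    HasDerivAt (Bn u v n) (Bn (dt u) v n s + Bn u (dt v) n s) s := by
  have hφ : Continuous (fun x => c2 n x * nq x) := ((c2_sm n).mul nq_sm).cont
  have hc : HasCompactSupport (fun x => c2 n x * nq x) := (c2_compact n).mul_right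
  have h := dInt hφ hc (hu.conj.mul hv) s
  have e : ∀ x, (c2 n x * nq x) * dt (fun t x => (starRingEnd ℂ) (u t x) * v t x) s x =
      (c2 n x * nq x) * ((starRingEnd ℂ) (dt u s x) * v s x)
       + (c2 n x * nq x) * ((starRingEnd ℂ) (u s x) * dt v s x) := by
    intro x
    rw [dt_mul hu.conj hv, dt_conj hu]; ring
  simp only [e] at h
  rw [integral_add (Sm.cmpInt hφ hc ((hu.dt.slice s).conj.mul (hv.slice s)).cont)
    (Sm.cmpInt hφ hc ((hu.slice s).conj.mul (hv.dt.slice s)).cont)] at h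
  exact h

lemma Bn_lim {u v : ℝ → E → ℂ} {s : ℝ} (hu : Sch (u s)) (hv : Sch (v s)) :
    Filter.Tendsto (fun n => Bn u v n s) Filter.atTop (nhds (BB u v s)) := by
  have := ct_lim (hu.nq_int hv)
  simpa only [Bn, BB, mul_assoc] using this

lemma Bn_le {u v : ℝ → E → ℂ} {s : ℝ} (hu : Sch (u s)) (hv : Sch (v s)) {n : ℕ} {C D : ℝ}
    (hC : ∫ x, ct n x ^ 2 * (‖x‖ ^ 2 * ‖u s x‖ ^ 2) ≤ C)
    (hD : ∫ x, ct n x ^ 2 * (‖x‖ ^ 2 * ‖v s x‖ ^ 2) ≤ D) :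
    ‖Bn u v n s‖ ≤ C + D := by
  have i1 := ct_int n (wt_cont hu.sm)
  have i2 := ct_int n (wt_cont hv.sm)
  refine le_trans ?_ (add_le_add hC hD)
  rw [← integral_add i1 i2]
  refine norm_integral_le_of_norm_le (i1.add i2) (Filter.Eventually.of_forall fun x => ?_)
  simp only [norm_mul, c2, norm_cc, nq, Complex.norm_real, RCLike.norm_conj, norm_pow, norm_norm]
  have p : 0 ≤ ct n x ^ 2 * ‖x‖ ^ 2 := by positivity
  nlinarith [mul_nonneg p (sq_nonneg (‖u s x‖ - ‖v s x‖)), mul_nonneg p (sq_nonneg (‖u s x‖)),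
    mul_nonneg p (sq_nonneg (‖v s x‖))]

lemma BB_der {V : E → ℝ} {B : ℝ} (hB : ∀ x, |V x| ≤ B) {W : ℕ → ℝ → E → ℂ} (hW : ∀ k, Hyp V (W k))
    (hs : ∀ k, W (k + 1) = dt (W k)) (k l : ℕ) (t : ℝ) :
    HasDerivAt (BB (W k) (W l)) (BB (W (k + 1)) (W l) t + BB (W k) (W (l + 1)) t) t := by
  have hd : ∀ k l n s, HasDerivAt (Bn (W k) (W l) n)
      (Bn (W (k + 1)) (W l) n s + Bn (W k) (W (l + 1)) n s) s := by
    intro k l n s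
    rw [hs, hs]
    exact Bn_der (hW k).sol.sm (hW l).sol.sm n s
  choose C hC using fun k => wt_bdd hB (hW k) (t - 1) (t + 1)
  have hb : ∀ k l n, ∀ s ∈ Set.Icc (t - 1) (t + 1), ‖Bn (W k) (W l) n s‖ ≤ C k + C l := fun k l n s hs' =>
    Bn_le ((hW k).s0 s) ((hW l).s0 s) (hC k n s hs') (hC l n s hs')
  refine lim_deriv (f := fun n => Bn (W k) (W l) n)
    (f1 := fun n s => Bn (W (k + 1)) (W l) n s + Bn (W k) (W (l + 1)) n s)
    (f2 := fun n s => (Bn (W (k + 1 + 1)) (W l) n s + Bn (W (k + 1)) (W (l + 1)) n s)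
      + (Bn (W (k + 1)) (W (l + 1)) n s + Bn (W k) (W (l + 1 + 1)) n s))
    (C := ((C (k + 1 + 1) + C l) + (C (k + 1) + C (l + 1)))
      + ((C (k + 1) + C (l + 1)) + (C k + C (l + 1 + 1))))
    (fun n s => hd k l n s) (fun n s => (hd (k+1) l n s).add (hd k (l+1) n s)) ?_
    (fun s => Bn_lim ((hW k).s0 s) ((hW l).s0 s))
    ((Bn_lim ((hW _).s0 t) ((hW l).s0 t)).add (Bn_lim ((hW k).s0 t) ((hW _).s0 t)))
  intro n s hs'
  exact (norm_add_le _ _).trans (add_le_add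
    ((norm_add_le _ _).trans (add_le_add (hb _ _ n s hs') (hb _ _ n s hs')))
    ((norm_add_le _ _).trans (add_le_add (hb _ _ n s hs') (hb _ _ n s hs'))))

/-! virial identity -/

structure D (j : Fin 3) (f : E → ℂ) (x : E) (a : ℂ) : Prop where
  sm : Sm f
  eq : dd j f x = a

lemma Sm.D {f : E → ℂ} (h : Sm f) (j x) : D j f x (DilId.dd j f x) := ⟨h, rfl⟩
lemma D.mul {j x} {f g : E → ℂ} {a b} (h : D j f x a) (h' : D j g x b) :
    D j (fun x => f x * g x) x (a * g x + f x * b) :=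
  ⟨h.sm.mul h'.sm, by rw [dd_mul h.sm h'.sm, h.eq, h'.eq]⟩
lemma D.add {j x} {f g : E → ℂ} {a b} (h : D j f x a) (h' : D j g x b) :
    D j (fun x => f x + g x) x (a + b) :=
  ⟨h.sm.add h'.sm, by rw [dd_add h.sm h'.sm, h.eq, h'.eq]⟩
lemma D.sub {j x} {f g : E → ℂ} {a b} (h : D j f x a) (h' : D j g x b) :
    D j (fun x => f x - g x) x (a - b) :=
  ⟨h.sm.sub h'.sm, by rw [dd_sub h.sm h'.sm, h.eq, h'.eq]⟩
lemma D.cmul {j x} {f : E → ℂ} {a} (c : ℂ) (h : D j f x a) :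
    D j (fun x => c * f x) x (c * a) :=
  ⟨(Sm.const c).mul h.sm, by rw [dd_const_mul c h.sm, h.eq]⟩
lemma D.sum {j x} {f : Fin 3 → E → ℂ} {a : Fin 3 → ℂ} (h : ∀ k, D j (f k) x (a k)) :
    D j (fun x => ∑ k, f k x) x (∑ k, a k) := by
  simp only [Fin.sum_univ_three]
  exact ((h 0).add (h 1)).add (h 2)

noncomputable def co (k : Fin 3) (x : E) : ℂ := ((x k : ℝ) : ℂ)
lemma co_temp (k) : (co k).HasTemperateGrowth := temp_coord k
lemma co_D (k j x) : D j (co k) x (if k = j then 1 else 0) := by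
  refine ⟨(co_temp k).1, ?_⟩
  have : co k = (ofRealCLM ∘L (EuclideanSpace.proj k : E →L[ℝ] ℝ)) := by ext x; simp [co]
  unfold dd
  rw [this, ContinuousLinearMap.fderiv]
  simp [ee, Pi.single_apply]
  try (split_ifs <;> simp)
lemma nq_D (j x) : D j nq x (2 * co j x) := ⟨nq_sm, dd_nq j x⟩

lemma dd_comm {f : E → ℂ} (h : Sm f) (j k x) : dd j (dd k f) x = dd k (dd j f) x := by
  have hd : DifferentiableAt ℝ (fderiv ℝ f) x :=
    (ContDiff.fderiv_right (m := ∞) h (by simp)).differentiable (by simp) _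
  have hs : IsSymmSndFDerivAt ℝ f x :=
    (ContDiff.contDiffAt h).isSymmSndFDerivAt (by simp; exact WithTop.coe_le_coe.2 (le_top (a := (2 : ℕ∞))))
  have e : ∀ j k, dd j (dd k f) x = fderiv ℝ (fderiv ℝ f) x (ee j) (ee k) := by
    intro j k
    show fderiv ℝ (fun x => fderiv ℝ f x (ee k)) x (ee j) = _
    rw [fderiv_clm_apply hd (by fun_prop)]; simp
  rw [e, e]; exact hs.eq _ _

lemma virial {Vc p q p1 q1 p2 q2 : E → ℂ} (hVt : Vc.HasTemperateGrowth) 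
    (hp : Sch p) (hq : Sch q) (hp1 : Sch p1) (hq1 : Sch q1)
    (ep1 : ∀ x, p1 x = I * (lap p x - Vc x * p x))
    (eq1 : ∀ x, q1 x = -I * (lap q x - Vc x * q x))
    (ep2 : ∀ x, p2 x = I * (lap p1 x - Vc x * p1 x))
    (eq2 : ∀ x, q2 x = -I * (lap q1 x - Vc x * q1 x)) :
    ∃ F : Fin 3 → E → ℂ, (∀ j, Sch (F j)) ∧ ∀ x,
      nq x * (q2 x * p x + 2 * (q1 x * p1 x) + q x * p2 x) =
        8 * (∑ j, dd j q x * dd j p x) - 4 * (∑ j, co j x * dd j Vc x) * (q x * p x)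
         + ∑ j, dd j (F j) x := by
  have hV : Sm Vc := hVt.1
  have sXP : Sch (fun x => ∑ k, co k x * dd k p x) := Sch.sum fun k => Sch.tmul (co_temp k) (hp.dd k)
  have sXQ : Sch (fun x => ∑ k, co k x * dd k q x) := Sch.sum fun k => Sch.tmul (co_temp k) (hq.dd k)
  have sS : Sch (fun x => ∑ k, dd k q x * dd k p x) := Sch.sum fun k => (hq.dd k).mul (hp.dd k)
  refine ⟨fun j x => ((nq x * (I * (((q1 x * dd j p x - p x * dd j q1 x)
      + q x * dd j p1 x) - p1 x * dd j q x)) + co j x * (2 * I * (p x * q1 x - q x * p1 x)))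
      + (-4) * ((dd j q x * (∑ k, co k x * dd k p x) + dd j p x * (∑ k, co k x * dd k q x))
          - co j x * (∑ k, dd k q x * dd k p x)))
      + ((-6) * (p x * dd j q x + q x * dd j p x) + co j x * (Vc x * (4 * (p x * q x)))),
    fun j => ?_, fun x => ?_⟩
  · refine Sch.add (Sch.add (Sch.add (Sch.tmul nq_temp (Sch.cmul _ ?_)) (Sch.tmul (co_temp j) (Sch.cmul _ ?_)))
      (Sch.cmul _ ?_)) (Sch.add (Sch.cmul _ ?_) (Sch.tmul (co_temp j) (Sch.tmul hVt (Sch.cmul _ ?_))))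
    · exact (((hq1.mul (hp.dd j)).sub (hp.mul (hq1.dd j))).add (hq.mul (hp1.dd j))).sub (hp1.mul (hq.dd j))
    · exact (hp.mul hq1).sub (hq.mul hp1)
    · exact (((hq.dd j).mul sXP).add ((hp.dd j).mul sXQ)).sub (Sch.tmul (co_temp j) sS)
    · exact (hp.mul (hq.dd j)).add (hq.mul (hp.dd j))
    · exact hp.mul hq
  · have dF := fun j => (((((nq_D j x).mul ((((((hq1.sm.D j x).mul ((hp.dd j).sm.D j x)).sub
        ((hp.sm.D j x).mul ((hq1.dd j).sm.D j x))).add ((hq.sm.D j x).mul ((hp1.dd j).sm.D j x))).sub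
        ((hp1.sm.D j x).mul ((hq.dd j).sm.D j x))).cmul I)).add
        ((co_D j j x).mul ((((hp.sm.D j x).mul (hq1.sm.D j x)).sub
          ((hq.sm.D j x).mul (hp1.sm.D j x))).cmul (2 * I)))).add
        ((((((hq.dd j).sm.D j x).mul (D.sum fun k => (co_D k j x).mul ((hp.dd k).sm.D j x))).add
          (((hp.dd j).sm.D j x).mul (D.sum fun k => (co_D k j x).mul ((hq.dd k).sm.D j x)))).sub
          ((co_D j j x).mul (D.sum fun k => ((hq.dd k).sm.D j x).mul ((hp.dd k).sm.D j x)))).cmul (-4))).add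
        (((((hp.sm.D j x).mul ((hq.dd j).sm.D j x)).add ((hq.sm.D j x).mul ((hp.dd j).sm.D j x))).cmul (-6)).add
          ((co_D j j x).mul ((hV.D j x).mul (((hp.sm.D j x).mul (hq.sm.D j x)).cmul 4))))).eq
    rw [Finset.sum_congr rfl fun j _ => dF j]
    clear dF
    have Hp1 := ep1 x
    have Hq1 := eq1 x
    have Hp2 := ep2 x
    have Hq2 := eq2 x
    simp only [lap, Fin.sum_univ_three, reduceIte, Fin.isValue] at *
    simp only [dd_comm hp.sm 1 0, dd_comm hp.sm 2 0, dd_comm hp.sm 2 1,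
      dd_comm hq.sm 1 0, dd_comm hq.sm 2 0, dd_comm hq.sm 2 1]
    simp only [show ((2:Fin 3) = 0) = False by simp, show ((2:Fin 3) = 1) = False by simp,
      show ((0:Fin 3) = 1) = False by simp, show ((0:Fin 3) = 2) = False by simp,
      show ((1:Fin 3) = 0) = False by simp, show ((1:Fin 3) = 2) = False by simp, if_false]
    linear_combination nq x * (p x * Hq2 + q x * Hp2 + q1 x * Hp1 + p1 x * Hq1)
      - 2 * I * (2 * (co 0 x * dd 0 p x + co 1 x * dd 1 p x + co 2 x * dd 2 p x) + 3 * p x) * Hq1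
      + 2 * I * (2 * (co 0 x * dd 0 q x + co 1 x * dd 1 q x + co 2 x * dd 2 q x) + 3 * q x) * Hp1
      + 2 * ((dd 0 (dd 0 q) x + dd 1 (dd 1 q) x + dd 2 (dd 2 q) x) - Vc x * q x) *
        (2 * (co 0 x * dd 0 p x + co 1 x * dd 1 p x + co 2 x * dd 2 p x) + 3 * p x) * I_sq
      + 2 * ((dd 0 (dd 0 p) x + dd 1 (dd 1 p) x + dd 2 (dd 2 p) x) - Vc x * p x) *
        (2 * (co 0 x * dd 0 q x + co 1 x * dd 1 q x + co 2 x * dd 2 q x) + 3 * q x) * I_sq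

end DilId

namespace DilId
open SchwartzMap Complex

noncomputable def WW (u : ℝ → E → ℂ) : ℕ → ℝ → E → ℂ
  | 0 => u
  | k + 1 => dt (WW u k)

lemma WW_it (u : ℝ → E → ℂ) (k : ℕ) : ∀ t x, WW u k t x = iteratedDeriv k (fun τ => u τ x) t := by
  induction k with
  | zero => intro t x; simp [WW]
  | succ k ih =>
    intro t x
    rw [iteratedDeriv_succ]
    show deriv (fun τ => WW u k τ x) t = _
    simp only [ih]

lemma dd_dd {f : E → ℂ} (h : Sm f) (j x) : dd j (dd j f) x = fderiv ℝ (fderiv ℝ f) x (ee j) (ee j) := by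
  have hd : DifferentiableAt ℝ (fderiv ℝ f) x :=
    (ContDiff.fderiv_right (m := ∞) h (by simp)).differentiable (by simp) _
  show fderiv ℝ (fun x => fderiv ℝ f x (ee j)) x (ee j) = _
  rw [fderiv_clm_apply hd (by fun_prop)]; simp

lemma mass_eq (u : ℝ → E → ℂ) (s : ℝ) :
    (∫ x, ‖x‖ ^ 2 * ‖u s x‖ ^ 2) = (BB u u s).re := by
  have : BB u u s = ((∫ x, ‖x‖ ^ 2 * ‖u s x‖ ^ 2 : ℝ) : ℂ) := by
    rw [← integral_complex_ofReal]
    unfold BB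
    refine integral_congr_ae (Filter.Eventually.of_forall fun x => ?_)
    simp only [nq, conj_mul']
    push_cast; ring
  rw [this, ofReal_re]

lemma re_der {f : ℝ → ℂ} {a : ℂ} {t : ℝ} (h : HasDerivAt f a t) :
    HasDerivAt (fun s => (f s).re) a.re t := by
  have := (reCLM.hasFDerivAt (x := f t)).comp_hasDerivAt t h
  exact this

lemma second {V : E → ℝ} (hV : ContDiff ℝ ∞ V)
    (hVt : (fun x => (V x : ℂ)).HasTemperateGrowth)
    {W : ℕ → ℝ → E → ℂ} (hW : ∀ k, Hyp V (W k))
    (hs : ∀ k, W (k + 1) = dt (W k)) (t : ℝ) :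
    (BB (W 2) (W 0) t + BB (W 1) (W 1) t) + (BB (W 1) (W 1) t + BB (W 0) (W 2) t) =
      ((∫ x, 8 * (∑ j : Fin 3, ‖fderiv ℝ (W 0 t) x (ee j)‖ ^ 2)
            - 4 * (∑ j : Fin 3, x j * fderiv ℝ V x (ee j)) * ‖W 0 t x‖ ^ 2 : ℝ) : ℂ) := by
  have ep : ∀ k x, W (k + 1) t x = I * (lap (W k t) x - V x * W k t x) := by
    intro k x; rw [hs]; exact (hW k).sol.eq t x
  have eq : ∀ k x, (starRingEnd ℂ) (W (k + 1) t x) =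
      -I * (lap (fun x => (starRingEnd ℂ) (W k t x)) x - V x * (starRingEnd ℂ) (W k t x)) := by
    intro k x; rw [ep, lap_conj]; simp
  have S := fun k => (hW k).s0 t
  obtain ⟨F, hF, h⟩ := virial hVt (S 0) (S 0).conj (S 1) (S 1).conj (ep 0) (eq 0) (ep 1) (eq 1)
  have hdF : Sch (fun x => ∑ j, dd j (F j) x) := Sch.sum fun j => (hF j).dd j
  unfold BB
  have N : ∀ k l, Sch (fun x => nq x * ((starRingEnd ℂ) (W k t x) * W l t x)) := fun k l =>
    Sch.tmul nq_temp ((S k).conj.mul (S l))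
  have i1 := integral_add (N 2 0).integrable (N 1 1).integrable
  have i2 := integral_add (N 1 1).integrable (N 0 2).integrable
  have i3 := integral_add ((N 2 0).add (N 1 1)).integrable ((N 1 1).add (N 0 2)).integrable
  have i4 := integral_sub (((N 2 0).add (N 1 1)).add ((N 1 1).add (N 0 2))).integrable hdF.integrable
  rw [Sch.int_div hF, sub_zero] at i4
  rw [← i1, ← i2, ← i3, ← i4, ← integral_complex_ofReal]
  refine integral_congr_ae (Filter.Eventually.of_forall fun x => ?_)
  have hx := h x
  have e1 : ∀ j, dd j (fun x => (starRingEnd ℂ) (W 0 t x)) x * dd j (W 0 t) x =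
      ((‖fderiv ℝ (W 0 t) x (ee j)‖ ^ 2 : ℝ) : ℂ) := by
    intro j; rw [dd_conj, conj_mul']; push_cast; rfl
  have e2 : (starRingEnd ℂ) (W 0 t x) * W 0 t x = ((‖W 0 t x‖ ^ 2 : ℝ) : ℂ) := by
    rw [conj_mul']; push_cast; rfl
  simp only [e1, e2, dd_ofReal (hV.differentiable (by simp)), co] at hx
  push_cast at hx ⊢
  linear_combination hx

theorem main
    (V : E → ℝ)
    (hV : ContDiff ℝ ∞ V)
    (hVbdd : ∀ n : ℕ, ∃ C : ℝ, ∀ x, ‖iteratedFDeriv ℝ n V x‖ ≤ C)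
    (ψ : ℝ → E → ℂ)
    (hψ : ContDiff ℝ ∞ (Function.uncurry ψ))
    (hSchwartz : ∀ (t : ℝ) (n : ℕ), ∃ φ : SchwartzMap E ℂ,
      ∀ x, iteratedDeriv n (fun τ => ψ τ x) t = φ x)
    (heq : ∀ (t : ℝ) (x : E),
      Complex.I * deriv (fun τ => ψ τ x) t
        = -(∑ j : Fin 3, fderiv ℝ (fderiv ℝ (ψ t)) x (ee j) (ee j))
          + (V x : ℂ) * ψ t x) :
    (∀ t : ℝ, DifferentiableAt ℝ (fun τ : ℝ => ∫ x : E, ‖x‖ ^ 2 * ‖ψ τ x‖ ^ 2) t) ∧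
    ∀ t : ℝ,
      HasDerivAt
        (deriv (fun τ : ℝ => ∫ x : E, ‖x‖ ^ 2 * ‖ψ τ x‖ ^ 2))
        (∫ x : E, 8 * (∑ j : Fin 3, ‖fderiv ℝ (ψ t) x (ee j)‖ ^ 2)
            - 4 * (∑ j : Fin 3, x j * fderiv ℝ V x (ee j)) * ‖ψ t x‖ ^ 2) t := by
  have h2 : Sm2 ψ := hψ
  have sol : Sol V ψ := by
    refine ⟨h2, fun t x => ?_⟩
    have h := heq t x
    simp only [← dd_dd (h2.slice t)] at h
    change I * dt ψ t x = -(lap (ψ t) x) + _ at h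
    linear_combination (-I) * h + (dt ψ t x) * I_sq
  have solW : ∀ k, Sol V (WW ψ k) := by
    intro k
    induction k with
    | zero => exact sol
    | succ k ih => exact ih.dt
  have schW : ∀ k t, Sch (WW ψ k t) := by
    intro k t
    obtain ⟨φ, h⟩ := hSchwartz t k
    exact ⟨φ, fun x => by rw [WW_it, h]⟩
  have hW : ∀ k, Hyp V (WW ψ k) := fun k => ⟨solW k, schW k, schW (k + 1)⟩
  have hs : ∀ k, WW ψ (k + 1) = dt (WW ψ k) := fun k => rfl
  obtain ⟨B, hB⟩ := hVbdd 0
  have hB' : ∀ x, |V x| ≤ B := fun x => by simpa using hB x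
  have der := BB_der hB' hW hs
  have e0 : (fun τ : ℝ => ∫ x : E, ‖x‖ ^ 2 * ‖ψ τ x‖ ^ 2) = fun s => (BB (WW ψ 0) (WW ψ 0) s).re :=
    funext fun s => mass_eq ψ s
  have d1 := fun t => re_der (der 0 0 t)
  rw [e0]
  refine ⟨fun t => (d1 t).differentiableAt, fun t => ?_⟩
  rw [funext fun t => (d1 t).deriv]
  have d2 := re_der ((der 1 0 t).add (der 0 1 t))
  have key := second hV (temp_V hV hVbdd) hW hs t
  rw [show (1 + 1 : ℕ) = 2 from rfl, show (0 + 1 : ℕ) = 1 from rfl, key, ofReal_re] at d2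
  exact d2

end DilId

/-- dilation / virial identity `∂²_t ⟨x²⟩ = ⟨8(-Δ) - 4 x·∇V⟩`.
For a smooth bounded potential `V` (with all derivatives bounded) and a smooth solution `ψ`
of `i ∂_t ψ = -Δψ + Vψ` which is Schwartz in `x`, with all time derivatives Schwartz in `x`
(a smooth curve in Schwartz space), the function `t ↦ ∫ ‖x‖² |ψ(t,x)|² dx` is twice
differentiable with second derivative `∫ (8‖∇ψ‖² - 4 (x·∇V)|ψ|²) dx`. -/
theorem dilation_identity_second_order
    (V : EuclideanSpace ℝ (Fin 3) → ℝ)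
    (hV : ContDiff ℝ ∞ V)
    (hVbdd : ∀ n : ℕ, ∃ C : ℝ, ∀ x, ‖iteratedFDeriv ℝ n V x‖ ≤ C)
    (ψ : ℝ → EuclideanSpace ℝ (Fin 3) → ℂ)
    (hψ : ContDiff ℝ ∞ (Function.uncurry ψ))
    (hSchwartz : ∀ (t : ℝ) (n : ℕ), ∃ φ : SchwartzMap (EuclideanSpace ℝ (Fin 3)) ℂ,
      ∀ x, iteratedDeriv n (fun τ => ψ τ x) t = φ x)
    (heq : ∀ (t : ℝ) (x : EuclideanSpace ℝ (Fin 3)),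
      Complex.I * deriv (fun τ => ψ τ x) t
        = -(∑ j : Fin 3, fderiv ℝ (fderiv ℝ (ψ t)) x (EuclideanSpace.single j 1)
              (EuclideanSpace.single j 1))
          + (V x : ℂ) * ψ t x) :
    (∀ t : ℝ, DifferentiableAt ℝ
        (fun τ : ℝ => ∫ x : EuclideanSpace ℝ (Fin 3), ‖x‖ ^ 2 * ‖ψ τ x‖ ^ 2) t) ∧
    ∀ t : ℝ,
      HasDerivAt
        (deriv (fun τ : ℝ => ∫ x : EuclideanSpace ℝ (Fin 3), ‖x‖ ^ 2 * ‖ψ τ x‖ ^ 2))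
        (∫ x : EuclideanSpace ℝ (Fin 3),
          8 * (∑ j : Fin 3, ‖fderiv ℝ (ψ t) x (EuclideanSpace.single j 1)‖ ^ 2)
            - 4 * (∑ j : Fin 3, x j * fderiv ℝ V x (EuclideanSpace.single j 1))
                * ‖ψ t x‖ ^ 2)
        t := by
  exact DilId.main V hV hVbdd ψ hψ hSchwartz heq
end

section
/- Let M ≥ 1 be a real number and set R = √M. Then for every real number a with |a − M| ≥ M, one has |a| / ( R · cosh²((a − M)/R) ) ≤ 8 · √M · e^{−2√M}. -/
/-- For `M ≥ 1`, `R = √M`, and any real `a` with `|a - M| ≥ M`,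
`|a| / (R cosh²((a-M)/R)) ≤ 8 √M e^{-2√M}`. -/
theorem abs_div_cosh_sq_le (M : ℝ) (hM : 1 ≤ M) (a : ℝ) (ha : M ≤ |a - M|) :
    |a| / (Real.sqrt M * Real.cosh ((a - M) / Real.sqrt M) ^ 2)
      ≤ 8 * Real.sqrt M * Real.exp (-2 * Real.sqrt M) := by
  have hr1 : 1 ≤ Real.sqrt M := Real.one_le_sqrt.mpr hM
  have hrr : Real.sqrt M * Real.sqrt M = M := Real.mul_self_sqrt (by linarith)
  set r := Real.sqrt M with hr
  have hr0 : 0 < r := by linarith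
  have hc0 : 0 < Real.cosh ((a - M) / r) := Real.cosh_pos _
  rw [div_le_iff₀ (by positivity)]
  obtain ⟨s, hs⟩ : ∃ s, s = |a - M| / r := ⟨_, rfl⟩
  have hst : |a - M| = r * s := by rw [hs]; field_simp
  have hsr : r ≤ s := by rw [hs, le_div_iff₀ hr0]; linarith
  have hcs : Real.cosh ((a - M) / r) = Real.cosh s := by
    rw [hs, ← Real.cosh_abs, abs_div, abs_of_pos hr0]
  have hc : Real.exp s / 2 ≤ Real.cosh s := by
    rw [Real.cosh_eq]; linarith [Real.exp_pos (-s)]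
  have hc2 : (Real.exp s / 2) ^ 2 ≤ Real.cosh s ^ 2 :=
    pow_le_pow_left₀ (by positivity) hc 2
  have he : Real.exp (-2 * r) * Real.exp s ^ 2 = Real.exp (2 * (s - r)) := by
    rw [sq, ← Real.exp_add, ← Real.exp_add]; congr 1; ring
  have h1 : 2 * (s - r) + 1 ≤ Real.exp (2 * (s - r)) := Real.add_one_le_exp _
  have h2 : s ≤ r * Real.exp (2 * (s - r)) := by nlinarith
  have h3 : |a| ≤ 2 * (r * s) := by
    have h := abs_add_le (a - M) M
    rw [sub_add_cancel, abs_of_pos (by linarith : (0:ℝ) < M)] at h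
    linarith
  rw [hcs]
  calc |a| ≤ 2 * (r * s) := h3
    _ ≤ 2 * (r * (r * Real.exp (2 * (s - r)))) := by gcongr
    _ = 8 * r * Real.exp (-2 * r) * (r * (Real.exp s / 2) ^ 2) := by rw [← he]; ring
    _ ≤ _ := by gcongr
end
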